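/- arXiv:1212.6503 — 9 statements merged into one kernel-verified Lean document; each statement's English description precedes it below -/
import Mathlib

section
/- Let D be a dense subset of a compact Hausdorff extremally disconnected space S, equipped with the relative topology. Then D is an extremally disconnected space. -/
/-- A dense subspace of an extremally disconnected space is extremally disconnected. -/
theorem Dense.extremallyDisconnected {X : Type*} [TopologicalSpace X]
    [ExtremallyDisconnected X] {D : Set X} (hD : Dense D) :
    ExtremallyDisconnected D where
  open_closure U hU := by
    obtain ⟨W, hW, rfl⟩ := isOpen_induced_iff.mp hU
    have hcl : closure (W ∩ D) = closure W :=
      (closure_mono Set.inter_subset_left).antisymm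
        (closure_minimal (hD.open_subset_closure_inter hW) isClosed_closure)
    rw [Topology.IsInducing.subtypeVal.closure_eq_preimage_closure_image,
      Set.image_preimage_eq_inter_range, Subtype.range_coe, hcl]
    exact (ExtremallyDisconnected.open_closure W hW).preimage continuous_subtype_val

/-- Let `D` be a dense subset of a compact Hausdorff extremally disconnected space `S`,
equipped with the relative topology.  Then `D` is an extremally disconnected space. -/
theorem stmt_2 {S : Type*} [TopologicalSpace S] [CompactSpace S] [T2Space S]
    [ExtremallyDisconnected S] (D : Set S) (hD : Dense D) :
    ExtremallyDisconnected D := by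
  exact hD.extremallyDisconnected
end

section
/- Let D be a dense subspace of a compact Hausdorff extremally disconnected space S. Then S is the Stone–Čech compactification of D: there exists a unique homeomorphism from βD onto S which restricts to the identity map on D (equivalently, the unique continuous map F : βD → S extending the inclusion of D into S is a homeomorphism). -/
open Filter Topology in
/-- If a continuous map `F` out of a Stone–Čech compactification restricts to an inducing map
on the original space, then the only point in the fibre of `F` over (the image of) a point of the
original space is that point itself. -/
theorem eq_stoneCechUnit_of_apply_eq {X Y : Type*} [TopologicalSpace X] [TopologicalSpace Y]
    {F : StoneCech X → Y} (hF : Continuous F) (hi : IsInducing (F ∘ stoneCechUnit))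
    {x : StoneCech X} {a : X} (h : F x = F (stoneCechUnit a)) : x = stoneCechUnit a := by
  have : NeBot (comap (stoneCechUnit : X → StoneCech X) (𝓝 x)) :=
    comap_neBot fun t ht ↦ by
      obtain ⟨b, hb⟩ := denseRange_stoneCechUnit.mem_nhds ht
      exact ⟨b, hb⟩
  have hx : Tendsto stoneCechUnit (comap (stoneCechUnit : X → StoneCech X) (𝓝 x)) (𝓝 x) :=
    tendsto_comap
  have ha : Tendsto id (comap (stoneCechUnit : X → StoneCech X) (𝓝 x)) (𝓝 a) := by
    rw [hi.tendsto_nhds_iff]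
    have := (hF.tendsto x).comp hx
    rwa [h] at this
  exact tendsto_nhds_unique hx ((continuous_stoneCechUnit.tendsto a).comp ha)

/-- Let `D` be a dense subspace of a compact Hausdorff extremally disconnected space `S`.
Then `S` is the Stone–Čech compactification of `D`: there exists a unique homeomorphism
from `βD` onto `S` which restricts to the identity map on `D`. -/
theorem stmt_5 {S : Type*} [TopologicalSpace S] [CompactSpace S] [T2Space S]
    [ExtremallyDisconnected S] (D : Set S) (hD : Dense D) :
    ∃! F : StoneCech D ≃ₜ S, ∀ d : D, F (stoneCechUnit d) = (d : S) := by
  have hval : Continuous (Subtype.val : D → S) := continuous_subtype_val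
  have hF := continuous_stoneCechExtend hval
  have hFD : stoneCechExtend hval ∘ stoneCechUnit = Subtype.val := stoneCechExtend_extends hval
  have hsurj : Function.Surjective (stoneCechExtend hval) := by
    rw [← Set.range_eq_univ, ← (isCompact_range hF).isClosed.closure_eq]
    refine (hD.mono fun d hd ↦ ?_).closure_eq
    exact ⟨stoneCechUnit ⟨d, hd⟩, stoneCechExtend_stoneCechUnit hval ⟨d, hd⟩⟩
  obtain ⟨s, hs, hFs⟩ := CompactT2.ExtremallyDisconnected.projective (A := S)
    continuous_id hF hsurj
  have hsF : s ∘ stoneCechExtend hval = id := by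
    refine stoneCech_hom_ext (hs.comp hF) continuous_id (funext fun d ↦ ?_)
    refine eq_stoneCechUnit_of_apply_eq hF (by rw [hFD]; exact .subtypeVal) ?_
    exact congrFun hFs _
  refine ⟨⟨⟨stoneCechExtend hval, s, congrFun hsF, congrFun hFs⟩, hF, hs⟩,
    stoneCechExtend_stoneCechUnit hval, fun G hG ↦ ?_⟩
  refine Homeomorph.ext fun x ↦ congrFun (stoneCech_hom_ext G.continuous hF ?_) x
  exact funext fun d ↦ (hG d).trans (stoneCechExtend_stoneCechUnit hval d).symm
end

section
/- Let X be a compact Hausdorff space, G a countable group acting on X by homeomorphisms, and x₀ ∈ X a point whose orbit {g•x₀ : g ∈ G} is both dense in X and free. Then there exists a G-invariant set Y which is a dense Gδ subset of X, contains x₀, and is such that for every g ∈ G other than the identity, g has no fixed point in Y (i.e., the action of G is free on Y). -/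
open Pointwise

/-- Let `X` be a compact Hausdorff space, `G` a countable group acting on `X` by
homeomorphisms, and `x₀ ∈ X` a point whose orbit is both dense in `X` and free.  Then
there exists a `G`-invariant set `Y` which is a dense `Gδ` subset of `X`, contains `x₀`,
and is such that every `g ∈ G` other than the identity has no fixed point in `Y`. -/
theorem stmt_8 {X : Type*} [TopologicalSpace X] [CompactSpace X] [T2Space X]
    {G : Type*} [Group G] [Countable G] [MulAction G X] [ContinuousConstSMul G X]
    (x₀ : X) (hdense : Dense (MulAction.orbit G x₀))
    (hfree : ∀ g : G, g ≠ 1 → g • x₀ ≠ x₀) :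
    ∃ Y : Set X, (∀ g : G, g • Y = Y) ∧ IsGδ Y ∧ Dense Y ∧ x₀ ∈ Y ∧
      ∀ y ∈ Y, ∀ g : G, g ≠ 1 → g • y ≠ y := by
  set Y : Set X := {y | ∀ g : G, g ≠ 1 → g • y ≠ y} with hY
  have smul_mem : ∀ (h : G), ∀ y ∈ Y, h • y ∈ Y := by
    intro h y hy g hg hfix
    refine hy (h⁻¹ * g * h) (fun hconj => hg ?_) ?_
    · have := congrArg (fun k => h * k * h⁻¹) hconj
      simpa [mul_assoc] using this
    · rw [mul_smul, mul_smul, hfix, inv_smul_smul]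
  refine ⟨Y, fun g => ?_, ?_, ?_, hfree, fun y hy => hy⟩
  · ext y
    rw [Set.mem_smul_set_iff_inv_smul_mem]
    exact ⟨fun hy => by simpa using smul_mem g _ hy, smul_mem g⁻¹ y⟩
  · have hinter : Y = ⋂ g : G, ⋂ _ : g ≠ 1, {y | g • y ≠ y} := by
      ext y
      simp [hY]
    rw [hinter]
    exact IsGδ.iInter fun g => IsGδ.iInter fun _ =>
      (isOpen_ne_fun (continuous_const_smul g) continuous_id).isGδ
  · refine hdense.mono ?_
    rintro _ ⟨g, rfl⟩
    exact smul_mem g x₀ hfree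
end

section
/- Let S be a compact Hausdorff extremally disconnected space with no isolated points, G a countably infinite group acting on S by homeomorphisms, s₀ ∈ S, and D = {g•s₀ : g ∈ G} a dense orbit. Let Γ be a countable infinite group of homeomorphisms of S which acts transitively on D. If Γ and G are strongly equivalent over D, then there exists a Gδ set Y with D ⊆ Y ⊆ S, invariant under the actions of both G and Γ, such that Γ and G are strongly equivalent over Y. -/
open Pointwise

/-- `A` is a clopen subset of `Z` in the relative topology of `Z`. -/
def RelClopen {S : Type*} [TopologicalSpace S] (Z A : Set S) : Prop :=
  A ⊆ Z ∧ IsClopen ((Subtype.val ⁻¹' A) : Set Z)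

/-- `h` is strongly decomposable over `Z` with respect to the action `act` of `G`:
there exist a sequence `(A j)` of pairwise disjoint clopen subsets of `Z` (in the relative
topology) whose union is `Z`, and a sequence `(g j)` in `G`, such that `h x = g j • x`
for every `x ∈ A j`. -/
def StronglyDecomposable {S G : Type*} [TopologicalSpace S]
    (act : G → S → S) (Z : Set S) (h : S → S) : Prop :=
  ∃ (A : ℕ → Set S) (g : ℕ → G),
    (∀ j, RelClopen Z (A j)) ∧
    (Pairwise fun i j => Disjoint (A i) (A j)) ∧
    (⋃ j, A j) = Z ∧
    ∀ j, ∀ x ∈ A j, h x = act (g j) x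

/-- Two groups `G` and `Γ` acting on `S` are strongly equivalent over `Z` if every element
of `Γ` is strongly `G`-decomposable over `Z` and every element of `G` is strongly
`Γ`-decomposable over `Z`. -/
def StronglyEquivalent {S G Γ : Type*} [TopologicalSpace S]
    (actG : G → S → S) (actΓ : Γ → S → S) (Z : Set S) : Prop :=
  (∀ γ : Γ, StronglyDecomposable actG Z (actΓ γ)) ∧
  (∀ g : G, StronglyDecomposable actΓ Z (actG g))

/-- A relatively clopen subset of a dense subset of an extremally disconnected space has clopen
closure, and is the trace of that closure. -/
theorem RelClopen.isClopen_closure {S : Type*} [TopologicalSpace S] [ExtremallyDisconnected S]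
    {D A : Set S} (hD : Dense D) (hA : RelClopen D A) :
    IsClopen (closure A) ∧ closure A ∩ D = A := by
  obtain ⟨hAD, hcl, hop⟩ := hA
  obtain ⟨U, hU, hUA⟩ := isOpen_induced_iff.mp hop
  obtain ⟨C, hC, hCA⟩ := isClosed_induced_iff.mp hcl
  have mem_iff_U : ∀ x ∈ D, (x ∈ U ↔ x ∈ A) := fun x hx => Set.ext_iff.mp hUA ⟨x, hx⟩
  have mem_iff_C : ∀ x ∈ D, (x ∈ C ↔ x ∈ A) := fun x hx => Set.ext_iff.mp hCA ⟨x, hx⟩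
  have hAU : A = U ∩ D := by
    ext x
    exact ⟨fun hx => ⟨(mem_iff_U x (hAD hx)).2 hx, hAD hx⟩, fun hx => (mem_iff_U x hx.2).1 hx.1⟩
  have hclosure : closure A = closure U := by
    rw [hAU]
    refine (closure_mono Set.inter_subset_left).antisymm (closure_minimal ?_ isClosed_closure)
    exact hD.open_subset_closure_inter hU
  refine ⟨⟨isClosed_closure, hclosure ▸ ExtremallyDisconnected.open_closure U hU⟩, ?_⟩
  refine Set.Subset.antisymm (fun x hx => ?_) fun x hx => ⟨subset_closure hx, hAD hx⟩
  have hAC : A ⊆ C := fun y hy => (mem_iff_C y (hAD hy)).2 hy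
  exact (mem_iff_C x hx.2).1 (closure_minimal hAC hC hx.1)

/-- A strong decomposition over a dense subset of an extremally disconnected space extends to
an open set, and hence restricts to every subset of that open set. -/
theorem StronglyDecomposable.exists_isOpen {S G : Type*} [TopologicalSpace S] [T2Space S]
    [ExtremallyDisconnected S] {act : G → S → S} (hact : ∀ g, Continuous (act g))
    {D : Set S} (hD : Dense D) {h : S → S} (hh : Continuous h)
    (hdec : StronglyDecomposable act D h) :
    ∃ U : Set S, IsOpen U ∧ D ⊆ U ∧ ∀ Y ⊆ U, StronglyDecomposable act Y h := by
  obtain ⟨A, g, hA, hdisj, hunion, heq⟩ := hdec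
  have hK := fun j => (hA j).isClopen_closure hD
  refine ⟨⋃ j, closure (A j), isOpen_iUnion fun j => (hK j).1.isOpen, ?_, fun Y hY => ?_⟩
  · rw [← hunion]
    exact Set.iUnion_mono fun j => subset_closure
  · refine ⟨fun j => closure (A j) ∩ Y, g, fun j => ⟨Set.inter_subset_right, ?_⟩,
      fun i j hij => ?_, ?_, fun j x hx => ?_⟩
    · rw [Set.preimage_inter, Subtype.coe_preimage_self, Set.inter_univ]
      exact (hK j).1.preimage continuous_subtype_val
    · refine Disjoint.mono Set.inter_subset_left Set.inter_subset_left ?_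
      rw [Set.disjoint_iff_inter_eq_empty, ← Set.not_nonempty_iff_eq_empty]
      intro hne
      obtain ⟨x, ⟨hxi, hxj⟩, hxD⟩ :=
        hD.inter_open_nonempty _ ((hK i).1.isOpen.inter (hK j).1.isOpen) hne
      exact Set.disjoint_left.mp (hdisj hij) ((hK i).2.subset ⟨hxi, hxD⟩)
        ((hK j).2.subset ⟨hxj, hxD⟩)
    · rw [← Set.iUnion_inter, Set.inter_eq_right.mpr hY]
    · exact closure_minimal (heq j) (isClosed_eq hh (hact (g j))) hx.1

theorem StronglyDecomposable.exists_eq {S G : Type*} [TopologicalSpace S] {act : G → S → S}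
    {Z : Set S} {h : S → S} (hdec : StronglyDecomposable act Z h) {x : S} (hx : x ∈ Z) :
    ∃ g, h x = act g x := by
  obtain ⟨A, g, -, -, hunion, heq⟩ := hdec
  obtain ⟨j, hj⟩ := Set.mem_iUnion.mp (hunion ▸ hx)
  exact ⟨g j, heq j x hj⟩

theorem smul_set_eq_of_forall_smul_mem {G S : Type*} [Group G] [MulAction G S] {Y : Set S}
    (hY : ∀ g : G, ∀ x ∈ Y, g • x ∈ Y) (g : G) : g • Y = Y := by
  ext x
  rw [Set.mem_smul_set_iff_inv_smul_mem]
  exact ⟨fun hx => by simpa using hY g _ hx, hY g⁻¹ x⟩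

/-- Let `S` be a compact Hausdorff extremally disconnected space with no isolated points,
`G` a countably infinite group acting on `S` by homeomorphisms, `s₀ ∈ S` and
`D = {g • s₀ : g ∈ G}` a dense orbit.  Let `Γ` be a countably infinite group of
homeomorphisms of `S` which leaves `D` invariant and acts transitively on `D`.  If `Γ` and
`G` are strongly equivalent over `D`, then there exists a `Gδ` set `Y` with `D ⊆ Y ⊆ S`,
invariant under the actions of both `G` and `Γ`, such that `Γ` and `G` are strongly
equivalent over `Y`. -/
theorem stmt_9 {S : Type*} [TopologicalSpace S] [CompactSpace S] [T2Space S]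
    [ExtremallyDisconnected S] (hiso : ∀ x : S, ¬ IsOpen ({x} : Set S))
    {G : Type*} [Group G] [Countable G] [Infinite G] [MulAction G S] [ContinuousConstSMul G S]
    {Γ : Type*} [Group Γ] [Countable Γ] [Infinite Γ] [MulAction Γ S] [ContinuousConstSMul Γ S]
    (s₀ : S) (D : Set S) (hDdef : D = MulAction.orbit G s₀) (hdense : Dense D)
    (hΓinv : ∀ γ : Γ, γ • D = D)
    (hΓtrans : ∀ x ∈ D, ∀ y ∈ D, ∃ γ : Γ, γ • x = y)
    (hse : StronglyEquivalent (fun (g : G) (x : S) => g • x)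
      (fun (γ : Γ) (x : S) => γ • x) D) :
    ∃ Y : Set S, D ⊆ Y ∧ IsGδ Y ∧
      (∀ g : G, g • Y = Y) ∧ (∀ γ : Γ, γ • Y = Y) ∧
      StronglyEquivalent (fun (g : G) (x : S) => g • x) (fun (γ : Γ) (x : S) => γ • x) Y := by
  choose U hUo hDU hU using fun γ =>
    (hse.1 γ).exists_isOpen (fun g => continuous_const_smul g) hdense (continuous_const_smul γ)
  choose V hVo hDV hV using fun g =>
    (hse.2 g).exists_isOpen (fun γ => continuous_const_smul γ) hdense (continuous_const_smul g)
  set W : Set S := (⋂ γ, U γ) ∩ ⋂ g, V g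
  have hWδ : IsGδ W := (IsGδ.iInter_of_isOpen hUo).inter (IsGδ.iInter_of_isOpen hVo)
  have hDW : D ⊆ W := Set.subset_inter (Set.subset_iInter hDU) (Set.subset_iInter hDV)
  set Y : Set S := ⋂ g : G, (g • ·) ⁻¹' W with hYdef
  have mem_Y : ∀ {x}, x ∈ Y ↔ ∀ g : G, g • x ∈ W := by simp [hYdef]
  have hYW : Y ⊆ W := fun x hx => by simpa using mem_Y.1 hx 1
  have hYU : ∀ γ, Y ⊆ U γ := fun γ x hx => Set.mem_iInter.1 (hYW hx).1 γ
  have hYV : ∀ g, Y ⊆ V g := fun g x hx => Set.mem_iInter.1 (hYW hx).2 g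
  have hGY : ∀ g : G, ∀ x ∈ Y, g • x ∈ Y := fun g x hx =>
    mem_Y.2 fun k => by simpa [mul_smul] using mem_Y.1 hx (k * g)
  refine ⟨Y, fun x hx => mem_Y.2 fun g => hDW ?_, ?_, smul_set_eq_of_forall_smul_mem hGY,
    smul_set_eq_of_forall_smul_mem fun γ x hx => ?_,
    fun γ => hU γ Y (hYU γ), fun g => hV g Y (hYV g)⟩
  · rw [hDdef] at hx ⊢
    exact MulAction.mem_orbit_of_mem_orbit g hx
  · exact IsGδ.iInter fun g => hWδ.preimage (continuous_const_smul g)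
  · obtain ⟨g, hg⟩ := (hU γ Y (hYU γ)).exists_eq hx
    exact hg ▸ hGY g x hx
end

section
/- Let S be a compact Hausdorff extremally disconnected space with no isolated points, G a countably infinite group acting on S by homeomorphisms, s₀ ∈ S, and D = {g•s₀ : g ∈ G} a dense orbit. Let Γ be a countable infinite group of homeomorphisms of S acting transitively on D, such that every element of Γ is strongly G-decomposable over D. If the action of G is pseudo-free on D, then Γ and G are strongly equivalent over D. -/
open Pointwise

/-- If the fixed-point sets of `G` are relatively open in `Z`, a continuous map which is strongly
`G`-decomposable over `Z` agrees with any given `g : G` on a relatively clopen set. -/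
theorem relClopen_setOf_eq_smul {S : Type*} [TopologicalSpace S] [T2Space S]
    {G : Type*} [Group G] [MulAction G S] [ContinuousConstSMul G S] {Z : Set S}
    (hpf : ∀ g : G, RelClopen Z {z ∈ Z | g • z = z}) {h : S → S} (hcont : Continuous h)
    (hdec : StronglyDecomposable (fun (g : G) (x : S) => g • x) Z h) (g : G) :
    RelClopen Z {x ∈ Z | h x = g • x} := by
  obtain ⟨A, k, hA, -, hAZ, hk⟩ := hdec
  refine ⟨fun x hx => hx.1, ?_, ?_⟩
  · have hset : (Subtype.val ⁻¹' {x ∈ Z | h x = g • x} : Set Z) = {x : Z | h x = g • (x : S)} := by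
      ext x
      simp
    rw [hset]
    exact isClosed_eq (hcont.comp continuous_subtype_val)
      (continuous_subtype_val.const_smul g)
  · have hset : (Subtype.val ⁻¹' {x ∈ Z | h x = g • x} : Set Z) =
        ⋃ j, Subtype.val ⁻¹' A j ∩ Subtype.val ⁻¹' {z ∈ Z | (g⁻¹ * k j) • z = z} := by
      ext x
      simp only [Set.mem_preimage, Set.mem_ofPred_eq, Set.mem_iUnion, Set.mem_inter_iff,
        Subtype.coe_prop, true_and, mul_smul, inv_smul_eq_iff]
      constructor
      · intro hx
        obtain ⟨j, hj⟩ := Set.mem_iUnion.1 (hAZ.symm ▸ x.2 : (x : S) ∈ ⋃ j, A j)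
        exact ⟨j, hj, (hk j x hj).symm.trans hx⟩
      · rintro ⟨j, hj, hx⟩
        exact (hk j x hj).trans hx
    rw [hset]
    exact isOpen_iUnion fun j => (hA j).2.isOpen.inter (hpf (g⁻¹ * k j)).2.isOpen

/-- A countable cover of `Z` by relatively clopen sets, on each of which `h` agrees with an element
of `Γ`, makes `h` strongly `Γ`-decomposable over `Z`. -/
theorem stronglyDecomposable_of_cover {S Γ : Type*} [TopologicalSpace S] {act : Γ → S → S}
    {Z : Set S} {h : S → S} (E : ℕ → Set S) (γ : ℕ → Γ) (hE : ∀ n, RelClopen Z (E n))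
    (hcover : ∀ x ∈ Z, ∃ n, x ∈ E n) (hγ : ∀ n, ∀ x ∈ E n, h x = act (γ n) x) :
    StronglyDecomposable act Z h := by
  refine ⟨disjointed E, γ, fun n => ⟨(disjointed_subset E n).trans (hE n).1, ?_⟩,
    disjoint_disjointed E, ?_, fun n x hx => hγ n x (disjointed_subset E n hx)⟩
  · exact disjointedRec (p := fun A => IsClopen (Subtype.val ⁻¹' A : Set Z))
      (fun _ i ht => ht.diff (hE i).2) (hE n).2
  · rw [iUnion_disjointed]
    exact Set.Subset.antisymm (Set.iUnion_subset fun n => (hE n).1)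
      fun x hx => Set.mem_iUnion.2 (hcover x hx)

/-- Let `S` be a compact Hausdorff extremally disconnected space with no isolated points,
`G` a countably infinite group acting on `S` by homeomorphisms, `s₀ ∈ S` and
`D = {g • s₀ : g ∈ G}` a dense orbit.  Let `Γ` be a countably infinite group of
homeomorphisms of `S` leaving `D` invariant and acting transitively on `D`, such that every
element of `Γ` is strongly `G`-decomposable over `D`.  If the action of `G` is pseudo-free
on `D`, then `Γ` and `G` are strongly equivalent over `D`. -/
theorem stmt_10 {S : Type*} [TopologicalSpace S] [CompactSpace S] [T2Space S]
    [ExtremallyDisconnected S] (hiso : ∀ x : S, ¬ IsOpen ({x} : Set S))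
    {G : Type*} [Group G] [Countable G] [Infinite G] [MulAction G S] [ContinuousConstSMul G S]
    {Γ : Type*} [Group Γ] [Countable Γ] [Infinite Γ] [MulAction Γ S] [ContinuousConstSMul Γ S]
    (s₀ : S) (D : Set S) (hDdef : D = MulAction.orbit G s₀) (hdense : Dense D)
    (hΓinv : ∀ γ : Γ, γ • D = D)
    (hΓtrans : ∀ x ∈ D, ∀ y ∈ D, ∃ γ : Γ, γ • x = y)
    (hΓdec : ∀ γ : Γ, StronglyDecomposable (fun (g : G) (x : S) => g • x) D
      (fun x : S => γ • x))
    (hpf : ∀ g : G, RelClopen D {z ∈ D | g • z = z}) :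
    StronglyEquivalent (fun (g : G) (x : S) => g • x) (fun (γ : Γ) (x : S) => γ • x) D := by
  refine ⟨hΓdec, fun g => ?_⟩
  obtain ⟨γ, hγ⟩ := exists_surjective_nat Γ
  refine stronglyDecomposable_of_cover (fun n => {x ∈ D | γ n • x = g • x}) γ
    (fun n => relClopen_setOf_eq_smul hpf (continuous_const_smul (γ n)) (hΓdec (γ n)) g)
    (fun x hx => ?_) fun n x hx => hx.2.symm
  have hgx : g • x ∈ D := by
    rw [hDdef] at hx ⊢
    exact MulAction.mem_orbit_of_mem_orbit g hx
  obtain ⟨δ, hδ⟩ := hΓtrans x hx (g • x) hgx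
  obtain ⟨n, rfl⟩ := hγ δ
  exact ⟨n, hx, hδ⟩
end

section
/- Let S be a compact Hausdorff extremally disconnected space with no isolated points, G a countably infinite group acting on S by homeomorphisms, s₀ ∈ S, and D = {g•s₀ : g ∈ G} a dense orbit. Let A and B be disjoint clopen subsets of D (in the relative topology), a ∈ A and b ∈ B. Then there exists a homeomorphism h of D onto D such that: h is strongly G-decomposable over D; h interchanges A and B (h[A] = B and h[B] = A) and fixes every point of D \ (A ∪ B); h(a) = b; and h = h⁻¹. -/
open Pointwise

section Exhaustion

variable {X : Type*}

/-- If a decreasing sequence of sets `P n` has empty intersection, then the successive pieces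
`U n = P n \ P (n + 1)` form a partition of `P 0`. -/
theorem pairwise_disjoint_and_iUnion_eq_of_succ_eq_diff {P U : ℕ → Set X}
    (hUP : ∀ n, U n ⊆ P n) (hP : ∀ n, P (n + 1) = P n \ U n) (hempty : ∀ x, ∃ n, x ∉ P n) :
    (Pairwise fun i j => Disjoint (U i) (U j)) ∧ ⋃ n, U n = P 0 := by
  have hanti : Antitone P := antitone_nat_of_succ_le fun n => by
    rw [hP]; exact Set.sdiff_subset
  have hlt : ∀ m n, m < n → Disjoint (U m) (U n) := fun m n hmn => by
    rw [Set.disjoint_left]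
    intro x hm hn
    have hx : x ∈ P (m + 1) := hanti hmn (hUP n hn)
    rw [hP] at hx
    exact hx.2 hm
  refine ⟨fun i j hij => ?_, Set.Subset.antisymm ?_ ?_⟩
  · rcases lt_or_gt_of_ne hij with h | h
    · exact hlt i j h
    · exact (hlt j i h).symm
  · exact Set.iUnion_subset fun n => (hUP n).trans (hanti (Nat.zero_le n))
  · intro x hx
    by_contra hxU
    rw [Set.mem_iUnion] at hxU
    push Not at hxU
    obtain ⟨n, hn⟩ := hempty x
    refine hn ?_
    clear hn
    induction n with
    | zero => exact hx
    | succ n ih => rw [hP]; exact ⟨ih, hxU n⟩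

end Exhaustion

/-- The map equal to `g n` on `U n`, to `(g n)⁻¹` on `g n • U n`, and to the identity
elsewhere. -/
theorem exists_swap_of_pairwise_disjoint {X G ι : Type*} [Group G] [MulAction G X] {U : ι → Set X} {g : ι → G}
    (hd : Pairwise fun i j => Disjoint (U i) (U j))
    (hd' : Pairwise fun i j => Disjoint (g i • U i) (g j • U j))
    (hAB : Disjoint (⋃ n, U n) (⋃ n, g n • U n)) :
    ∃ h : X → X, (∀ n, ∀ x ∈ U n, h x = g n • x) ∧ (∀ n, ∀ x ∈ g n • U n, h x = (g n)⁻¹ • x) ∧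
      ∀ x, x ∉ (⋃ n, U n) ∪ ⋃ n, g n • U n → h x = x := by
  classical
  refine ⟨fun x => if hx : ∃ n, x ∈ U n then g hx.choose • x else
    if hx : ∃ n, x ∈ g n • U n then (g hx.choose)⁻¹ • x else x, ?_, ?_, ?_⟩
  · intro n x hx
    have hex : ∃ n, x ∈ U n := ⟨n, hx⟩
    have hn : hex.choose = n := hd.eq (Set.not_disjoint_iff.2 ⟨x, hex.choose_spec, hx⟩)
    simp only [dif_pos hex, hn]
  · intro n x hx
    have hex : ∃ n, x ∈ g n • U n := ⟨n, hx⟩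
    have hnex : ¬ ∃ n, x ∈ U n := fun h =>
      Set.disjoint_left.1 hAB (Set.mem_iUnion.2 h) (Set.mem_iUnion.2 hex)
    have hn : hex.choose = n := hd'.eq (Set.not_disjoint_iff.2 ⟨x, hex.choose_spec, hx⟩)
    simp only [dif_neg hnex, dif_pos hex, hn]
  · intro x hx
    rw [Set.mem_union, Set.mem_iUnion, Set.mem_iUnion, not_or] at hx
    simp only [dif_neg hx.1, dif_neg hx.2]

section Pieces

variable {X G : Type*} [TopologicalSpace X] [Group G] [MulAction G X]

/-- In a zero-dimensional space without isolated points and with a transitive action, a point of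
an open set `P` has a clopen neighbourhood which some group element carries into a given open
set `Q`, in such a way that neither `P` nor `Q` is exhausted. -/
theorem exists_isClopen_smul_subset [T1Space X] [ContinuousConstSMul G X]
    [MulAction.IsPretransitive G X]
    (hbasis : ∀ (x : X) (V : Set X), IsOpen V → x ∈ V → ∃ U, IsClopen U ∧ x ∈ U ∧ U ⊆ V)
    (hiso : ∀ x : X, ¬ IsOpen ({x} : Set X)) {P Q : Set X} (hP : IsOpen P) (hQ : IsOpen Q)
    {x y : X} (hx : x ∈ P) (hy : y ∈ Q) :
    ∃ (U : Set X) (g : G), IsClopen U ∧ x ∈ U ∧ g • x = y ∧ U ⊆ P ∧ g • U ⊆ Q ∧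
      (P \ U).Nonempty ∧ (Q \ g • U).Nonempty := by
  have hne : ∀ (R : Set X) (z : X), IsOpen R → z ∈ R → ∃ w ∈ R, w ≠ z := fun R z hR hz => by
    by_contra! hcon
    exact hiso z (by rwa [← Set.eq_singleton_iff_unique_mem.2 ⟨hz, hcon⟩])
  obtain ⟨p, hpP, hpx⟩ := hne P x hP hx
  obtain ⟨q, hqQ, hqy⟩ := hne Q y hQ hy
  obtain ⟨g, rfl⟩ := MulAction.exists_smul_eq G x y
  obtain ⟨U, hU, hxU, hUV⟩ := hbasis x ((P ∩ {p}ᶜ) ∩ (g • ·) ⁻¹' (Q ∩ {q}ᶜ))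
    ((hP.inter isOpen_compl_singleton).inter
      ((hQ.inter isOpen_compl_singleton).preimage (continuous_const_smul g)))
    ⟨⟨hx, hpx.symm⟩, hy, hqy.symm⟩
  refine ⟨U, g, hU, hxU, rfl, fun z hz => (hUV hz).1.1, ?_, ⟨p, hpP, fun h => (hUV h).1.2 rfl⟩,
    ⟨q, hqQ, ?_⟩⟩
  · rintro _ ⟨z, hz, rfl⟩
    exact (hUV hz).2.1
  · rintro ⟨z, hz, hzq⟩
    exact (hUV hz).2.2 hzq

/-- Two disjoint nonempty clopen sets `A`, `B` of a countable zero-dimensional space without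
isolated points are countably equidecomposable under a transitive action, with clopen pieces,
in such a way that a given point of `A` is moved to a given point of `B`. -/
theorem exists_isClopen_partition_smul [Countable X] [T1Space X] [ContinuousConstSMul G X]
    [MulAction.IsPretransitive G X]
    (hbasis : ∀ (x : X) (V : Set X), IsOpen V → x ∈ V → ∃ U, IsClopen U ∧ x ∈ U ∧ U ⊆ V)
    (hiso : ∀ x : X, ¬ IsOpen ({x} : Set X)) {A B : Set X} (hA : IsClopen A) (hB : IsClopen B)
    (hAB : Disjoint A B) {a b : X} (ha : a ∈ A) (hb : b ∈ B) :
    ∃ (U : ℕ → Set X) (g : ℕ → G), (∀ n, IsClopen (U n)) ∧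
      (Pairwise fun i j => Disjoint (U i) (U j)) ∧ ⋃ n, U n = A ∧
      (Pairwise fun i j => Disjoint (g i • U i) (g j • U j)) ∧ ⋃ n, g n • U n = B ∧
      a ∈ U 0 ∧ g 0 • a = b := by
  let σ := {p : Set X × Set X // IsClopen p.1 ∧ IsClopen p.2 ∧ p.1.Nonempty ∧ p.2.Nonempty ∧
    Disjoint p.1 p.2}
  have hstep : ∀ (s : σ) (z : X × X), ∃ (U : Set X) (g : G), IsClopen U ∧
      U ⊆ s.1.1 ∧ g • U ⊆ s.1.2 ∧ (s.1.1 \ U).Nonempty ∧ (s.1.2 \ g • U).Nonempty ∧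
      z.1 ∉ s.1.1 \ U ∧ z.1 ∉ s.1.2 \ g • U ∧
      (z.1 ∈ s.1.1 → z.2 ∈ s.1.2 → z.1 ∈ U ∧ g • z.1 = z.2) := by
    rintro ⟨⟨P, Q⟩, hP, hQ, ⟨p, hp⟩, ⟨q, hq⟩, hPQ⟩ ⟨x, y⟩
    dsimp only at hP hQ hp hq hPQ ⊢
    by_cases hx : x ∈ P
    · have hxQ : x ∉ Q := Set.disjoint_left.1 hPQ hx
      obtain ⟨y', hy', hyy⟩ : ∃ y' ∈ Q, y ∈ Q → y' = y := by
        by_cases hy : y ∈ Q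
        · exact ⟨y, hy, fun _ => rfl⟩
        · exact ⟨q, hq, fun h => absurd h hy⟩
      obtain ⟨U, g, h1, h2, h3, h4, h5, h6, h7⟩ :=
        exists_isClopen_smul_subset (G := G) hbasis hiso hP.isOpen hQ.isOpen hx hy'
      exact ⟨U, g, h1, h4, h5, h6, h7, fun h => h.2 h2, fun h => hxQ h.1,
        fun _ hy => ⟨h2, h3.trans (hyy hy)⟩⟩
    · obtain ⟨y', hy', hyy⟩ : ∃ y' ∈ Q, x ∈ Q → y' = x := by
        by_cases hy : x ∈ Q
        · exact ⟨x, hy, fun _ => rfl⟩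
        · exact ⟨q, hq, fun h => absurd h hy⟩
      obtain ⟨U, g, h1, h2, h3, h4, h5, h6, h7⟩ :=
        exists_isClopen_smul_subset (G := G) hbasis hiso hP.isOpen hQ.isOpen hp hy'
      exact ⟨U, g, h1, h4, h5, h6, h7, fun h => hx h.1,
        fun h => h.2 ⟨p, h2, h3.trans (hyy h.1)⟩, fun h => absurd h hx⟩
  choose U g hU hUP hgU hne hne' hz hz' hab using hstep
  let next : σ → X × X → σ := fun s z => ⟨(s.1.1 \ U s z, s.1.2 \ g s z • U s z),
    s.2.1.diff (hU s z), s.2.2.1.diff ⟨(hU s z).isClosed.smul _, (hU s z).isOpen.smul _⟩,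
    hne s z, hne' s z, s.2.2.2.2.2.mono Set.sdiff_subset Set.sdiff_subset⟩
  have : Nonempty X := ⟨a⟩
  obtain ⟨e, he⟩ := exists_surjective_nat X
  let z : ℕ → X × X := fun n => Nat.casesOn n (a, b) fun m => (e m, b)
  let s : ℕ → σ := fun n =>
    Nat.rec (⟨(A, B), hA, hB, ⟨a, ha⟩, ⟨b, hb⟩, hAB⟩ : σ) (fun n s => next s (z n)) n
  obtain ⟨hd, hu⟩ := pairwise_disjoint_and_iUnion_eq_of_succ_eq_diff
    (P := fun n => (s n).1.1) (U := fun n => U (s n) (z n)) (fun n => hUP _ _) (fun n => rfl)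
    (fun x => by obtain ⟨n, rfl⟩ := he x; exact ⟨n + 2, hz (s (n + 1)) (z (n + 1))⟩)
  obtain ⟨hd', hu'⟩ := pairwise_disjoint_and_iUnion_eq_of_succ_eq_diff
    (P := fun n => (s n).1.2) (U := fun n => g (s n) (z n) • U (s n) (z n))
    (fun n => hgU _ _) (fun n => rfl)
    (fun x => by obtain ⟨n, rfl⟩ := he x; exact ⟨n + 2, hz' (s (n + 1)) (z (n + 1))⟩)
  exact ⟨fun n => U (s n) (z n), fun n => g (s n) (z n), fun n => hU _ _, hd, hu, hd', hu',
    hab (s 0) (z 0) ha hb⟩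

/-- Two disjoint nonempty clopen sets are interchanged by an involution that is the identity
elsewhere and locally coincides with elements of `G`. -/
theorem exists_involutive_swap [Countable X] [T1Space X] [ContinuousConstSMul G X]
    [MulAction.IsPretransitive G X]
    (hbasis : ∀ (x : X) (V : Set X), IsOpen V → x ∈ V → ∃ U, IsClopen U ∧ x ∈ U ∧ U ⊆ V)
    (hiso : ∀ x : X, ¬ IsOpen ({x} : Set X)) {A B : Set X} (hA : IsClopen A) (hB : IsClopen B)
    (hAB : Disjoint A B) {a b : X} (ha : a ∈ A) (hb : b ∈ B) :
    ∃ h : X → X, Function.Involutive h ∧ Set.MapsTo h A B ∧ Set.MapsTo h B A ∧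
      (∀ x, x ∉ A ∪ B → h x = x) ∧ h a = b ∧
      ∀ x, ∃ (V : Set X) (g : G), IsClopen V ∧ x ∈ V ∧ ∀ y ∈ V, h y = g • y := by
  obtain ⟨U, g, hU, hd, rfl, hd', rfl, ha0, hab⟩ :=
    exists_isClopen_partition_smul (G := G) hbasis hiso hA hB hAB ha hb
  obtain ⟨h, h1, h2, h3⟩ := exists_swap_of_pairwise_disjoint hd hd' hAB
  have hcases : ∀ x, (∃ n, x ∈ U n) ∨ (∃ n, x ∈ g n • U n) ∨
      x ∉ (⋃ n, U n) ∪ ⋃ n, g n • U n := fun x => by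
    rw [Set.mem_union, Set.mem_iUnion, Set.mem_iUnion]; tauto
  refine ⟨h, fun x => ?_, fun x hx => ?_, fun x hx => ?_, h3, (h1 0 a ha0).trans hab,
    fun x => ?_⟩
  · rcases hcases x with ⟨n, hn⟩ | ⟨n, hn⟩ | hx
    · rw [h1 n x hn, h2 n _ (Set.smul_mem_smul_set hn), inv_smul_smul]
    · rw [h2 n x hn, h1 n _ (Set.mem_smul_set_iff_inv_smul_mem.1 hn), smul_inv_smul]
    · rw [h3 x hx, h3 x hx]
  · obtain ⟨n, hn⟩ := Set.mem_iUnion.1 hx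
    rw [h1 n x hn]
    exact Set.mem_iUnion.2 ⟨n, Set.smul_mem_smul_set hn⟩
  · obtain ⟨n, hn⟩ := Set.mem_iUnion.1 hx
    rw [h2 n x hn]
    exact Set.mem_iUnion.2 ⟨n, Set.mem_smul_set_iff_inv_smul_mem.1 hn⟩
  · rcases hcases x with ⟨n, hn⟩ | ⟨n, hn⟩ | hx
    · exact ⟨U n, g n, hU n, hn, h1 n⟩
    · exact ⟨g n • U n, (g n)⁻¹, ⟨(hU n).isClosed.smul _, (hU n).isOpen.smul _⟩, hn, h2 n⟩
    · exact ⟨_, 1, (hA.union hB).compl, hx, fun y hy => by rw [h3 y hy, one_smul]⟩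

end Pieces

/-- A map of a countable set `Z` that locally coincides with elements of `G` is strongly
decomposable over `Z`. -/
theorem stronglyDecomposable_of_locally {S G : Type*} [TopologicalSpace S] {act : G → S → S}
    {Z : Set S} [Countable Z] [Nonempty Z] {h : S → S}
    (hloc : ∀ x : Z, ∃ (V : Set Z) (g : G), IsClopen V ∧ x ∈ V ∧
      ∀ y ∈ V, h (y : S) = act g y) :
    StronglyDecomposable act Z h := by
  choose V g hV hmem hg using hloc
  obtain ⟨e, he⟩ := exists_surjective_nat Z
  have hclopen : ∀ n, IsClopen (disjointed (fun n => V (e n)) n) := fun n =>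
    disjointedRec (fun _ i ht => ht.diff (hV (e i))) (hV (e n))
  refine ⟨fun n => Subtype.val '' disjointed (fun n => V (e n)) n, fun n => g (e n),
    fun n => ⟨?_, ?_⟩, fun i j hij => ?_, ?_, ?_⟩
  · exact Subtype.coe_image_subset _ _
  · rw [Set.preimage_image_eq _ Subtype.val_injective]
    exact hclopen n
  · exact (Set.disjoint_image_iff Subtype.val_injective).2 (disjoint_disjointed _ hij)
  · have hcover : ⋃ n, V (e n) = Set.univ := Set.eq_univ_of_forall fun x => by
      obtain ⟨n, rfl⟩ := he x
      exact Set.mem_iUnion.2 ⟨n, hmem _⟩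
    rw [← Set.image_iUnion, iUnion_disjointed, hcover, Set.image_univ, Subtype.range_coe]
  · rintro n _ ⟨y, hy, rfl⟩
    exact hg _ y (disjointed_subset _ n hy)

/-- A dense subspace of a T1 space without isolated points has no isolated points. -/
theorem Dense.not_isOpen_singleton_subtype {S : Type*} [TopologicalSpace S] [T1Space S]
    {D : Set S} (hD : Dense D) (hiso : ∀ x : S, ¬ IsOpen ({x} : Set S)) (x : D) :
    ¬ IsOpen ({x} : Set D) := by
  rintro hx
  obtain ⟨V, hV, hVx⟩ := isOpen_induced_iff.1 hx
  have hmem : ∀ y : D, (y : S) ∈ V ↔ y = x := fun y => by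
    rw [← Set.mem_singleton_iff, ← hVx, Set.mem_preimage]
  refine hiso x ?_
  convert hV
  refine (Set.eq_singleton_iff_unique_mem.2 ⟨(hmem x).2 rfl, fun y hy => ?_⟩).symm
  by_contra hyx
  obtain ⟨w, ⟨hwV, hwx⟩, hwD⟩ := hD.inter_open_nonempty (V ∩ {(x : S)}ᶜ)
    (hV.inter isOpen_compl_singleton) ⟨y, hy, hyx⟩
  exact hwx (congrArg Subtype.val ((hmem ⟨w, hwD⟩).1 hwV))

/-- Let `S` be a compact Hausdorff extremally disconnected space with no isolated points,
`G` a countably infinite group acting on `S` by homeomorphisms, `s₀ ∈ S` and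
`D = {g • s₀ : g ∈ G}` a dense orbit.  Let `A` and `B` be disjoint clopen subsets of `D`
(in the relative topology), `a ∈ A` and `b ∈ B`.  Then there exists a homeomorphism `h`
of `D` onto `D` (formalised by a map `h : S → S` carrying `D` into `D`, continuous on `D`,
and equal to its own inverse on `D`) such that: `h` is strongly `G`-decomposable over `D`;
`h` interchanges `A` and `B` and fixes every point of `D \ (A ∪ B)`; and `h a = b`. -/
theorem stmt_11 {S : Type*} [TopologicalSpace S] [CompactSpace S] [T2Space S]
    [ExtremallyDisconnected S] (hiso : ∀ x : S, ¬ IsOpen ({x} : Set S))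
    {G : Type*} [Group G] [Countable G] [Infinite G] [MulAction G S] [ContinuousConstSMul G S]
    (s₀ : S) (D : Set S) (hDdef : D = MulAction.orbit G s₀) (hdense : Dense D)
    (A B : Set S) (hA : RelClopen D A) (hB : RelClopen D B) (hAB : Disjoint A B)
    (a : S) (ha : a ∈ A) (b : S) (hb : b ∈ B) :
    ∃ h : S → S, Set.MapsTo h D D ∧ ContinuousOn h D ∧
      (∀ x ∈ D, h (h x) = x) ∧
      StronglyDecomposable (fun (g : G) (x : S) => g • x) D h ∧
      h '' A = B ∧ h '' B = A ∧ (∀ x ∈ D \ (A ∪ B), h x = x) ∧ h a = b := by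
  subst hDdef
  have : Countable (MulAction.orbit G s₀) := Set.countable_range fun g : G => g • s₀
  have : Nonempty (MulAction.orbit G s₀) := ⟨⟨a, hA.1 ha⟩⟩
  have : ContinuousConstSMul G (MulAction.orbit G s₀) :=
    ⟨fun g => (continuous_subtype_val.const_smul g).subtype_mk _⟩
  have hbasis : ∀ (x : MulAction.orbit G s₀) (V : Set (MulAction.orbit G s₀)), IsOpen V →
      x ∈ V → ∃ U, IsClopen U ∧ x ∈ U ∧ U ⊆ V := by
    rintro x V hV hx
    obtain ⟨W, hW, rfl⟩ := isOpen_induced_iff.1 hV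
    obtain ⟨U, hU, hxU, hUW⟩ := compact_exists_isClopen_in_isOpen hW hx
    exact ⟨Subtype.val ⁻¹' U, hU.preimage continuous_subtype_val, hxU, Set.preimage_mono hUW⟩
  obtain ⟨h, hinv, hmAB, hmBA, hfix, hab, hloc⟩ := exists_involutive_swap (G := G) hbasis
    (hdense.not_isOpen_singleton_subtype hiso) hA.2 hB.2 (hAB.preimage _)
    (a := ⟨a, hA.1 ha⟩) (b := ⟨b, hB.1 hb⟩) ha hb
  classical
  let k : S → S := fun x => if hx : x ∈ MulAction.orbit G s₀ then h ⟨x, hx⟩ else x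
  have hk : ∀ x : MulAction.orbit G s₀, k x = h x := fun x => dif_pos x.2
  have hkk : ∀ x ∈ MulAction.orbit G s₀, k (k x) = x := fun x hx => by
    rw [hk ⟨x, hx⟩, hk, hinv]
  have hkAB : Set.MapsTo k A B := fun x hx => by
    rw [hk ⟨x, hA.1 hx⟩]; exact hmAB hx
  have hkBA : Set.MapsTo k B A := fun x hx => by
    rw [hk ⟨x, hB.1 hx⟩]; exact hmBA hx
  have hcont : Continuous h := continuous_iff_continuousAt.2 fun x => by
    obtain ⟨V, g, hV, hxV, hg⟩ := hloc x
    exact (continuous_const_smul g).continuousAt.congr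
      (Filter.mem_of_superset (hV.isOpen.mem_nhds hxV) fun y hy => (hg y hy).symm)
  refine ⟨k, fun x hx => ?_, ?_, hkk, ?_, ?_, ?_, fun x hx => ?_, ?_⟩
  · rw [hk ⟨x, hx⟩]; exact (h _).2
  · rw [continuousOn_iff_continuous_domRestrict]
    exact (continuous_subtype_val.comp hcont).congr fun x => (hk x).symm
  · refine stronglyDecomposable_of_locally fun x => ?_
    obtain ⟨V, g, hV, hxV, hg⟩ := hloc x
    exact ⟨V, g, hV, hxV, fun y hy => by rw [hk, hg y hy]; rfl⟩
  · exact Set.Subset.antisymm hkAB.image_subset fun x hx => ⟨k x, hkBA hx, hkk x (hB.1 hx)⟩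
  · exact Set.Subset.antisymm hkBA.image_subset fun x hx => ⟨k x, hkAB hx, hkk x (hA.1 hx)⟩
  · rw [hk ⟨x, hx.1⟩, hfix ⟨x, hx.1⟩ hx.2]
  · rw [hk ⟨a, hA.1 ha⟩, hab]
end

section
/- Let S be a compact Hausdorff extremally disconnected space with no isolated points, G a countably infinite group, and ε : G → Homeo(S) an injective action of G on S by homeomorphisms. Let s₀ ∈ S be such that the orbit D = {ε_g(s₀) : g ∈ G} is dense in S and the action is pseudo-free on D. Then there exist a group homomorphism γ from the dyadic group ⊕ℤ₂ (the direct sum of countably many copies of ℤ/2ℤ) into Homeo(S) and a Gδ subset Y of S with D ⊆ Y such that: (1) the orbit {γ_δ(s₀) : δ ∈ ⊕ℤ₂} is free and coincides with D; (2) Y is invariant under both ε[G] and γ[⊕ℤ₂], and these two groups of homeomorphisms are strongly equivalent over Y; (3) the orbit equivalence relations on Y induced by ε[G] and by γ[⊕ℤ₂] coincide; (4) γ is injective. -/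
section DyadicAction

open Set Filter Topology

/-- `f` agrees near every point with the action of some element of `G`. -/
def LocallyActs (G : Type*) {X : Type*} [TopologicalSpace X] [SMul G X] (f : X → X) : Prop :=
  ∀ x, ∃ g : G, ∀ᶠ y in 𝓝 x, f y = g • y

section LocallyActs

variable {G X : Type*} [Group G] [MulAction G X] [TopologicalSpace X]

theorem LocallyActs.id : LocallyActs G (fun x : X => x) := fun _ => ⟨1, by simp⟩

open Classical in
theorem LocallyActs.ite {f f' : X → X} (hf : LocallyActs G f) (hf' : LocallyActs G f')
    {U : Set X} (hU : IsClopen U) : LocallyActs G (fun x => if x ∈ U then f x else f' x) := by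
  intro x
  by_cases hx : x ∈ U
  · obtain ⟨g, hg⟩ := hf x
    refine ⟨g, ?_⟩
    filter_upwards [hg, hU.isOpen.mem_nhds hx] with y h1 h2
    rw [if_pos h2, h1]
  · obtain ⟨g, hg⟩ := hf' x
    refine ⟨g, ?_⟩
    filter_upwards [hg, hU.compl.isOpen.mem_nhds hx] with y h1 h2
    rw [if_neg h2, h1]

variable [ContinuousConstSMul G X]

theorem LocallyActs.continuous {f : X → X} (hf : LocallyActs G f) : Continuous f := by
  refine continuous_iff_continuousAt.2 fun x => ?_
  obtain ⟨g, hg⟩ := hf x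
  exact (continuous_const_smul g).continuousAt.congr (hg.mono fun _ h => h.symm)

theorem LocallyActs.comp {f f' : X → X} (hf : LocallyActs G f) (hf' : LocallyActs G f') :
    LocallyActs G (fun x => f (f' x)) := by
  intro x
  obtain ⟨a, ha⟩ := hf' x
  obtain ⟨b, hb⟩ := hf (f' x)
  refine ⟨b * a, ?_⟩
  filter_upwards [ha, hf'.continuous.continuousAt.eventually hb] with y h1 h2
  rw [h2, h1, mul_smul]

end LocallyActs

theorem exists_seq_of_forall_exists {α : Type*} {P : α → Prop} {R : ℕ → α → α → Prop} {a : α}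
    (ha : P a) (h : ∀ n x, P x → ∃ y, P y ∧ R n x y) :
    ∃ f : ℕ → α, f 0 = a ∧ (∀ n, P (f n)) ∧ ∀ n, R n (f n) (f (n + 1)) := by
  choose! s hP hR using h
  let f : ℕ → α := fun n => Nat.rec a s n
  have hf : ∀ n, P (f n) := fun n => by
    induction n with
    | zero => exact ha
    | succ n ih => exact hP n _ ih
  exact ⟨f, rfl, hf, fun n => hR n _ (hf n)⟩

/-- `f` is an involution of `K`, locally given by `G`, that exchanges the disjoint clopen subsets
`A` and `B` of `K` and fixes all other points. -/
structure PartialSwap (G : Type*) {X : Type*} [TopologicalSpace X] [SMul G X]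
    (K A B : Set X) (f : X → X) : Prop where
  left_clopen : IsClopen A
  right_clopen : IsClopen B
  left_subset : A ⊆ K
  right_subset : B ⊆ K
  disjoint : ∀ x ∈ A, x ∉ B
  invol : ∀ x, f (f x) = x
  locallyActs : LocallyActs G f
  map_left : ∀ x ∈ A, f x ∈ B
  map_right : ∀ x ∈ B, f x ∈ A
  map_other : ∀ x, x ∉ A → x ∉ B → f x = x

theorem exists_ne_mem_of_isOpen {X : Type*} [TopologicalSpace X]
    (hiso : ∀ x : X, ¬ IsOpen ({x} : Set X)) {U : Set X}
    (hU : IsOpen U) {x : X} (hx : x ∈ U) : ∃ y ∈ U, x ≠ y := by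
  by_contra! hcon
  refine hiso x ?_
  convert hU
  ext y
  exact ⟨fun h => h ▸ hx, fun h => (hcon y h).symm⟩

section Swap

variable {G X : Type*} [Group G] [MulAction G X] [TopologicalSpace X]
  [ContinuousConstSMul G X] [MulAction.IsPretransitive G X] [T2Space X]

open Classical in
theorem PartialSwap.exists_extension
    (hb : TopologicalSpace.IsTopologicalBasis {s : Set X | IsClopen s})
    {K A B : Set X} (hK : IsClopen K) {f : X → X} (h : PartialSwap G K A B f) {k k' : X}
    (hne : k ≠ k') (hk : k ∈ K \ (A ∪ B)) (hk' : k' ∈ K \ (A ∪ B)) :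
    ∃ A' B' f', PartialSwap G K A' B' f' ∧ A ⊆ A' ∧ B ⊆ B' ∧ (∀ x ∈ A ∪ B, f' x = f x) ∧
      k ∈ A' ∧ f' k = k' := by
  obtain ⟨g, hg⟩ := MulAction.exists_smul_eq G k k'
  obtain ⟨u, v, hu, hv, hku, hkv, huv⟩ := t2_separation hne
  have hW : IsClopen (K \ (A ∪ B)) := hK.diff (h.left_clopen.union h.right_clopen)
  have hN : IsOpen ((K \ (A ∪ B)) ∩ u ∩ (fun x => g • x) ⁻¹' ((K \ (A ∪ B)) ∩ v)) :=
    (hW.isOpen.inter hu).inter ((hW.isOpen.inter hv).preimage (continuous_const_smul g))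
  have hkN : k ∈ (K \ (A ∪ B)) ∩ u ∩ (fun x => g • x) ⁻¹' ((K \ (A ∪ B)) ∩ v) :=
    ⟨⟨hk, hku⟩, by rw [mem_preimage, hg]; exact ⟨hk', hkv⟩⟩
  obtain ⟨U, hU, hkU, hUN⟩ := hb.exists_subset_of_mem_open hkN hN
  have hU : IsClopen U := hU
  set V : Set X := (fun x => g⁻¹ • x) ⁻¹' U with hVdef
  have hV : IsClopen V := hU.preimage (continuous_const_smul g⁻¹)
  have hUW : ∀ x ∈ U, x ∈ K ∧ x ∉ A ∧ x ∉ B := fun x hx => by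
    have := (hUN hx).1.1
    simpa [not_or] using this
  have hVW : ∀ x ∈ V, x ∈ K ∧ x ∉ A ∧ x ∉ B := fun x hx => by
    have := (hUN hx).2.1
    simpa [not_or] using this
  have hUV : ∀ x ∈ U, x ∉ V := fun x hx hx' => by
    have h1 := (hUN hx').2.2
    simp only [smul_inv_smul] at h1
    exact disjoint_left.1 huv (hUN hx).1.2 h1
  have hgU : ∀ x ∈ U, g • x ∈ V := fun x hx => by simpa [hVdef] using hx
  have hgV : ∀ x ∈ V, g⁻¹ • x ∈ U := fun x hx => hx
  have hl (a : G) : LocallyActs G (fun x : X => a • x) := fun x => ⟨a, by simp⟩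
  have fU : ∀ x ∉ U, x ∉ V → f x ∉ U ∧ f x ∉ V := by
    intro x hxU hxV
    by_cases hA : x ∈ A
    · have := h.map_left x hA
      exact ⟨fun h' => (hUW _ h').2.2 this, fun h' => (hVW _ h').2.2 this⟩
    by_cases hB : x ∈ B
    · have := h.map_right x hB
      exact ⟨fun h' => (hUW _ h').2.1 this, fun h' => (hVW _ h').2.1 this⟩
    rw [h.map_other x hA hB]; exact ⟨hxU, hxV⟩
  refine ⟨A ∪ U, B ∪ V, fun x => if x ∈ U then g • x else if x ∈ V then g⁻¹ • x else f x,
    ⟨h.left_clopen.union hU, h.right_clopen.union hV,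
      union_subset h.left_subset fun x hx => (hUW x hx).1,
      union_subset h.right_subset fun x hx => (hVW x hx).1, ?_, ?_,
      (hl g).ite ((hl g⁻¹).ite h.locallyActs hV) hU, ?_, ?_, ?_⟩,
    subset_union_left, subset_union_left, ?_, Or.inr hkU, ?_⟩
  · rintro x (hx | hx) (hx' | hx')
    · exact h.disjoint x hx hx'
    · exact (hVW x hx').2.1 hx
    · exact (hUW x hx).2.2 hx'
    · exact hUV x hx hx'
  · intro x
    by_cases hxU : x ∈ U
    · have h1 := hgU x hxU
      have h2 : g • x ∉ U := fun h' => hUV _ h' h1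
      simp [hxU, h1, h2]
    by_cases hxV : x ∈ V
    · simp [hxU, hxV, hgV x hxV]
    · simp [hxU, hxV, fU x hxU hxV, h.invol]
  · rintro x (hx | hx)
    · have h1 : x ∉ U := fun h' => (hUW x h').2.1 hx
      have h2 : x ∉ V := fun h' => (hVW x h').2.1 hx
      simpa [h1, h2] using Or.inl (h.map_left x hx)
    · simpa [hx] using Or.inr (hgU x hx)
  · rintro x (hx | hx)
    · have h1 : x ∉ U := fun h' => (hUW x h').2.2 hx
      have h2 : x ∉ V := fun h' => (hVW x h').2.2 hx
      simpa [h1, h2] using Or.inl (h.map_right x hx)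
    · have h1 : x ∉ U := fun h' => hUV x h' hx
      simpa [hx, h1] using Or.inr (hgV x hx)
  · intro x hx hx'
    simp only [mem_union, not_or] at hx hx'
    simp [hx.2, hx'.2, h.map_other x hx.1 hx'.1]
  · rintro x hx
    have h1 : x ∉ U := fun h' => hx.elim (hUW x h').2.1 (hUW x h').2.2
    have h2 : x ∉ V := fun h' => hx.elim (hVW x h').2.1 (hVW x h').2.2
    simp [h1, h2]
  · simp [hkU, hg]

/-- A clopen set can be cut into two clopen halves exchanged by an involution which is locally
given by `G` and maps one prescribed point to another. -/
theorem exists_involution_of_ne [Countable X]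
    (hb : TopologicalSpace.IsTopologicalBasis {s : Set X | IsClopen s}) (hiso : ∀ x : X, ¬ IsOpen ({x} : Set X))
    {K : Set X} (hK : IsClopen K) {s t : X} (hs : s ∈ K) (ht : t ∈ K) (hst : s ≠ t) :
    ∃ (K' : Set X) (h : X → X), IsClopen K' ∧ K' ⊆ K ∧ s ∈ K' ∧ (∀ x, h (h x) = x) ∧
      LocallyActs G h ∧ (∀ x ∈ K, h x ∈ K) ∧ (∀ x ∈ K, h x ∈ K' ↔ x ∉ K') ∧ h s = t := by
  have : Nonempty X := ⟨s⟩
  obtain ⟨e, he⟩ := exists_surjective_nat X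
  have h0 : PartialSwap G K ∅ ∅ (fun x : X => x) :=
    ⟨isClopen_empty, isClopen_empty, empty_subset _, empty_subset _, by simp, by simp,
      LocallyActs.id, by simp, by simp, by simp⟩
  obtain ⟨A₀, B₀, f₀, hP₀, -, -, -, hsA, hft⟩ :=
    h0.exists_extension hb hK hst (by simpa using hs) (by simpa using ht)
  obtain ⟨F, hF0, hFP, hFR⟩ := exists_seq_of_forall_exists
    (α := Set X × Set X × (X → X)) (P := fun a => PartialSwap G K a.1 a.2.1 a.2.2)
    (R := fun n a b => a.1 ⊆ b.1 ∧ a.2.1 ⊆ b.2.1 ∧ (∀ x ∈ a.1 ∪ a.2.1, b.2.2 x = a.2.2 x) ∧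
      (e n ∈ K → e n ∈ b.1 ∪ b.2.1)) (a := (A₀, B₀, f₀)) hP₀ (by
    rintro n ⟨A, B, f⟩ h
    by_cases hn : e n ∈ K \ (A ∪ B)
    · obtain ⟨k', hk', hne⟩ := exists_ne_mem_of_isOpen hiso
        (hK.diff (h.left_clopen.union h.right_clopen)).isOpen hn
      obtain ⟨A', B', f', h1, h2, h3, h4, h5, -⟩ := h.exists_extension hb hK hne hn hk'
      exact ⟨(A', B', f'), h1, h2, h3, h4, fun _ => Or.inl h5⟩
    · refine ⟨(A, B, f), h, Subset.rfl, Subset.rfl, fun _ _ => rfl, fun hk => ?_⟩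
      by_contra hcon
      exact hn ⟨hk, hcon⟩)
  have hA : Monotone fun n => (F n).1 := monotone_nat_of_le_succ fun n => (hFR n).1
  have hB : Monotone fun n => (F n).2.1 := monotone_nat_of_le_succ fun n => (hFR n).2.1
  have hstab : ∀ m n, m ≤ n → ∀ x ∈ (F m).1 ∪ (F m).2.1, (F n).2.2 x = (F m).2.2 x := by
    intro m n hmn x hx
    induction n, hmn using Nat.le_induction with
    | base => rfl
    | succ n hmn ih =>
      rw [← ih]
      exact (hFR n).2.2.1 x (hx.imp (fun h => hA hmn h) (fun h => hB hmn h))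
  have hcov : ∀ x ∈ K, ∃ n, x ∈ (F n).1 ∪ (F n).2.1 := by
    intro x hx
    obtain ⟨n, rfl⟩ := he x
    exact ⟨n + 1, (hFR n).2.2.2 hx⟩
  have hlim : ∀ x, ∃ y, ∀ n, x ∉ K ∨ x ∈ (F n).1 ∪ (F n).2.1 → (F n).2.2 x = y := by
    intro x
    by_cases hx : x ∈ K
    · obtain ⟨m, hm⟩ := hcov x hx
      refine ⟨(F m).2.2 x, fun n hn => ?_⟩
      replace hn := hn.resolve_left (not_not.2 hx)
      rcases le_total m n with h | h
      · exact hstab m n h x hm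
      · exact (hstab n m h x hn).symm
    · exact ⟨x, fun n _ => (hFP n).map_other x (fun h => hx ((hFP n).left_subset h))
        fun h => hx ((hFP n).right_subset h)⟩
  choose h hh using hlim
  have hhK : ∀ x ∉ K, h x = x := fun x hx => by
    rw [← hh x 0 (Or.inl hx)]
    exact (hFP 0).map_other x (fun h => hx ((hFP 0).left_subset h))
        fun h => hx ((hFP 0).right_subset h)
  have hAB : ∀ m n, ∀ x ∈ (F m).1, x ∉ (F n).2.1 := fun m n x hm hn =>
    (hFP (max m n)).disjoint x (hA (le_max_left m n) hm) (hB (le_max_right m n) hn)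
  have hsub : (⋃ n, (F n).1) ⊆ K := iUnion_subset fun n => (hFP n).left_subset
  have hcompl : (⋃ n, (F n).1)ᶜ = Kᶜ ∪ ⋃ n, (F n).2.1 := by
    ext x
    simp only [mem_compl_iff, mem_iUnion, not_exists, mem_union]
    constructor
    · intro hx
      by_cases hxK : x ∈ K
      · obtain ⟨n, hn⟩ := hcov x hxK
        exact Or.inr ⟨n, hn.resolve_left (hx n)⟩
      · exact Or.inl hxK
    · rintro (hx | ⟨m, hm⟩) n hn
      · exact hx ((hFP n).left_subset hn)
      · exact hAB n m x hn hm
  have hmapA : ∀ n, ∀ x ∈ (F n).1, h x ∈ (F n).2.1 := fun n x hx => by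
    rw [← hh x n (Or.inr (Or.inl hx))]; exact (hFP n).map_left x hx
  have hmapB : ∀ n, ∀ x ∈ (F n).2.1, h x ∈ (F n).1 := fun n x hx => by
    rw [← hh x n (Or.inr (Or.inr hx))]; exact (hFP n).map_right x hx
  refine ⟨⋃ n, (F n).1, h, ⟨⟨?_⟩, isOpen_iUnion fun n => (hFP n).left_clopen.isOpen⟩, hsub,
    mem_iUnion.2 ⟨0, by rw [hF0]; exact hsA⟩, ?_, ?_, ?_, ?_, ?_⟩
  · rw [hcompl]
    exact hK.compl.isOpen.union (isOpen_iUnion fun n => (hFP n).right_clopen.isOpen)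
  · intro x
    by_cases hx : x ∈ K
    · obtain ⟨n, hn⟩ := hcov x hx
      have h1 : h x ∈ (F n).1 ∪ (F n).2.1 :=
        hn.elim (fun h' => Or.inr (hmapA n x h')) (fun h' => Or.inl (hmapB n x h'))
      rw [← hh (h x) n (Or.inr h1), ← hh x n (Or.inr hn), (hFP n).invol]
    · rw [hhK x hx, hhK x hx]
  · intro x
    by_cases hx : x ∈ K
    · obtain ⟨n, hn⟩ := hcov x hx
      obtain ⟨g, hg⟩ := (hFP n).locallyActs x
      refine ⟨g, ?_⟩
      filter_upwards [hg,
        ((hFP n).left_clopen.union (hFP n).right_clopen).isOpen.mem_nhds hn] with y h1 h2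
      rw [← h1, hh y n (Or.inr h2)]
    · refine ⟨1, ?_⟩
      filter_upwards [hK.compl.isOpen.mem_nhds hx] with y hy
      rw [hhK y hy, one_smul]
  · intro x hx
    obtain ⟨n, hn⟩ := hcov x hx
    exact hn.elim (fun h' => (hFP n).right_subset (hmapA n x h'))
      (fun h' => (hFP n).left_subset (hmapB n x h'))
  · intro x hx
    simp only [mem_iUnion, not_exists]
    constructor
    · rintro ⟨m, hm⟩ n hn
      exact hAB m n _ hm (hmapA n x hn)
    · intro hn
      obtain ⟨n, hn'⟩ := hcov x hx
      exact ⟨n, hmapB n x (hn'.resolve_left (hn n))⟩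
  · rw [← hh s 0 (Or.inr (Or.inl (by rw [hF0]; exact hsA))), hF0]
    exact hft

theorem exists_involution [Countable X]
    (hb : TopologicalSpace.IsTopologicalBasis {s : Set X | IsClopen s}) (hiso : ∀ x : X, ¬ IsOpen ({x} : Set X))
    {K : Set X} (hK : IsClopen K) {s t : X} (hs : s ∈ K) (ht : t ∈ K) :
    ∃ (K' : Set X) (h : X → X), IsClopen K' ∧ K' ⊆ K ∧ s ∈ K' ∧ (∀ x, h (h x) = x) ∧
      LocallyActs G h ∧ (∀ x ∈ K, h x ∈ K) ∧ (∀ x ∈ K, h x ∈ K' ↔ x ∉ K') ∧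
      (s ≠ t → h s = t) := by
  by_cases hst : s = t
  · obtain ⟨t', ht', hne⟩ := exists_ne_mem_of_isOpen hiso hK.isOpen hs
    obtain ⟨K', h, h1, h2, h3, h4, h5, h6, h7, -⟩ :=
      exists_involution_of_ne (G := G) hb hiso hK hs ht' hne
    exact ⟨K', h, h1, h2, h3, h4, h5, h6, h7, fun h => absurd hst h⟩
  · obtain ⟨K', h, h1, h2, h3, h4, h5, h6, h7, h8⟩ :=
      exists_involution_of_ne (G := G) hb hiso hK hs ht hst
    exact ⟨K', h, h1, h2, h3, h4, h5, h6, h7, fun _ => h8⟩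

open Classical in
/-- A countable space without isolated points on which `G` acts transitively is in bijection with
the dyadic group in such a way that translations are locally given by `G`. -/
theorem exists_equiv_dyadic [Countable X]
    (hb : TopologicalSpace.IsTopologicalBasis {s : Set X | IsClopen s}) (hiso : ∀ x : X, ¬ IsOpen ({x} : Set X))
    (x₀ : X) :
    ∃ θ : X ≃ (ℕ →₀ ZMod 2), ∀ δ, LocallyActs G (fun x => θ.symm (θ x + δ)) := by
  have : Nonempty X := ⟨x₀⟩
  obtain ⟨e, he⟩ := exists_surjective_nat X
  obtain ⟨F, hF0, hFP, hFR⟩ := exists_seq_of_forall_exists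
    (α := Set X × (X → X))
    (P := fun a => IsClopen a.1 ∧ x₀ ∈ a.1 ∧ (∀ x, a.2 x ∈ a.1) ∧ LocallyActs G a.2)
    (R := fun n a b => ∃ h : X → X, (∀ x, h (h x) = x) ∧ LocallyActs G h ∧
      (∀ x ∈ a.1, h x ∈ a.1) ∧ (∀ x ∈ a.1, h x ∈ b.1 ↔ x ∉ b.1) ∧ b.1 ⊆ a.1 ∧
      (∀ x, b.2 x = if a.2 x ∈ b.1 then a.2 x else h (a.2 x)) ∧ b.2 (e n) = x₀)
    (a := (univ, fun x => x)) ⟨isClopen_univ, mem_univ _, fun _ => mem_univ _, LocallyActs.id⟩ (by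
      rintro n ⟨K, p⟩ ⟨h1, h2, h3, h4⟩
      obtain ⟨K', h, g1, g2, g3, g4, g5, g6, g7, g8⟩ :=
        exists_involution (G := G) hb hiso h1 h2 (h3 (e n))
      refine ⟨(K', fun x => if p x ∈ K' then p x else h (p x)), ⟨g1, g3, ?_, ?_⟩,
        h, g4, g5, g6, g7, g2, fun _ => rfl, ?_⟩
      · intro x
        dsimp only
        split_ifs with hx
        · exact hx
        · exact (g7 _ (h3 x)).2 hx
      · exact (LocallyActs.ite LocallyActs.id g5 g1).comp h4
      · dsimp only
        by_cases hx : x₀ = p (e n)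
        · rw [← hx, if_pos g3]
        · have g9 : h x₀ = p (e n) := g8 hx
          have g10 : p (e n) ∉ K' := by
            rw [← g9, g7 _ h2]
            exact not_not.2 g3
          rw [if_neg g10, ← g9, g4])
  choose h hinv hloc hmaps hswap hsub hp hpe using hFR
  set K : ℕ → Set X := fun n => (F n).1 with hKdef
  set p : ℕ → X → X := fun n => (F n).2 with hpdef
  have hp0 : ∀ x, p 0 x = x := fun x => by simp [hpdef, hF0]
  replace hp : ∀ n x, p (n + 1) x = if p n x ∈ K (n + 1) then p n x else h n (p n x) := hp
  replace hpe : ∀ n, p (n + 1) (e n) = x₀ := hpe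
  have hKc : ∀ n, IsClopen (K n) := fun n => (hFP n).1
  have hx₀ : ∀ n, x₀ ∈ K n := fun n => (hFP n).2.1
  have hpK : ∀ n x, p n x ∈ K n := fun n => (hFP n).2.2.1
  have hpl : ∀ n, LocallyActs G (p n) := fun n => (hFP n).2.2.2
  replace hmaps : ∀ n, ∀ x ∈ K n, h n x ∈ K n := hmaps
  replace hswap : ∀ n, ∀ x ∈ K n, h n x ∈ K (n + 1) ↔ x ∉ K (n + 1) := hswap
  replace hsub : ∀ n, K (n + 1) ⊆ K n := hsub
  clear_value K p
  have hstay : ∀ x m n, m ≤ n → p m x = x₀ → p n x = x₀ := by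
    intro x m n hmn hm
    induction n, hmn using Nat.le_induction with
    | base => exact hm
    | succ n _ ih => rw [hp, ih, if_pos (hx₀ _)]
  let d : X → ℕ → ZMod 2 := fun x n => if p n x ∈ K (n + 1) then 0 else 1
  have hd0 : ∀ x m n, m ≤ n → p m x = x₀ → d x n = 0 := fun x m n hmn hm => by
    simp only [d]; rw [hstay x m n hmn hm, if_pos (hx₀ _)]
  have hfin : ∀ x, (Function.support (d x)).Finite := by
    intro x
    obtain ⟨n, rfl⟩ := he x
    refine (finite_lt_nat (n + 1)).subset fun m hm => ?_
    by_contra hlt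
    exact hm (hd0 _ (n + 1) m (not_lt.1 hlt) (hpe n))
  let Θ : X → (ℕ →₀ ZMod 2) := fun x => Finsupp.ofSupportFinite (d x) (hfin x)
  have hΘ : ∀ x n, Θ x n = d x n := fun _ _ => rfl
  have hinj : ∀ n x y, (∀ m < n, d x m = d y m) → p n x = p n y → x = y := by
    intro n x y
    induction n with
    | zero => intro _ hxy; simpa [hp0] using hxy
    | succ n ih =>
      intro hd hxy
      refine ih (fun m hm => hd m (by omega)) ?_
      have := hd n (by omega)
      simp only [d] at this
      rw [hp, hp] at hxy
      split_ifs at hxy this with h1 h2 h2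
      · exact hxy
      · simp at this
      · simp at this
      · rw [← hinv n (p n x), hxy, hinv]
  have hsurj : ∀ (c : ℕ → ZMod 2) n, ∀ z ∈ K n, ∃ x, p n x = z ∧ ∀ m < n, d x m = c m := by
    intro c n
    induction n with
    | zero => exact fun z _ => ⟨z, hp0 z, by simp⟩
    | succ n ih =>
      intro z hz
      by_cases hc : c n = 0
      · obtain ⟨x, hx, hx'⟩ := ih z (hsub n hz)
        refine ⟨x, by rw [hp, hx, if_pos hz], fun m hm => ?_⟩
        rcases Nat.lt_succ_iff_lt_or_eq.1 hm with hm | rfl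
        · exact hx' m hm
        · simp only [d]; rw [hx, if_pos hz, hc]
      · have hc1 : c n = 1 := by
          generalize c n = a at hc
          revert a; decide
        have hz' : h n z ∉ K (n + 1) := by
          rw [hswap n z (hsub n hz)]; exact not_not.2 hz
        obtain ⟨x, hx, hx'⟩ := ih (h n z) (hmaps n z (hsub n hz))
        refine ⟨x, by rw [hp, hx, if_neg hz', hinv], fun m hm => ?_⟩
        rcases Nat.lt_succ_iff_lt_or_eq.1 hm with hm | rfl
        · exact hx' m hm
        · simp only [d]; rw [hx, if_neg hz', hc1]
  have hreach : ∀ x, ∃ n, p n x = x₀ := fun x => by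
    obtain ⟨n, rfl⟩ := he x
    exact ⟨n + 1, hpe n⟩
  have hbij : Function.Bijective Θ := by
    constructor
    · intro x y hxy
      obtain ⟨n, hn⟩ := hreach x
      obtain ⟨m, hm⟩ := hreach y
      refine hinj (max n m) x y (fun k _ => DFunLike.congr_fun hxy k) ?_
      rw [hstay x n _ (le_max_left n m) hn, hstay y m _ (le_max_right n m) hm]
    · intro δ
      obtain ⟨N, hN⟩ : ∃ N, ∀ n, N ≤ n → δ n = 0 := by
        refine ⟨δ.support.sup id + 1, fun n hn => ?_⟩
        by_contra hne
        have := Finset.le_sup (f := id) (Finsupp.mem_support_iff.2 hne)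
        simp only [id] at this
        omega
      obtain ⟨x, hx, hx'⟩ := hsurj δ N x₀ (hx₀ N)
      refine ⟨x, Finsupp.ext fun n => ?_⟩
      rw [hΘ]
      rcases lt_or_ge n N with hn | hn
      · exact hx' n hn
      · rw [hN n hn, hd0 x N n hn hx]
  let θ : X ≃ (ℕ →₀ ZMod 2) := Equiv.ofBijective Θ hbij
  have hθ : ∀ x n, θ x n = d x n := fun _ _ => rfl
  have hflip : ∀ n x u, (∀ m < n, d u m = d x m) → p n u = h n (p n x) →
      θ u = θ x + Finsupp.single n 1 := by
    intro n x u hd hu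
    have hnext : p (n + 1) u = p (n + 1) x := by
      rw [hp, hp, hu]
      have := hswap n (p n x) (hpK n x)
      by_cases hx : p n x ∈ K (n + 1)
      · rw [if_neg (fun h' => this.1 h' hx), if_pos hx, hinv]
      · rw [if_pos (this.2 hx), if_neg hx]
    have hlater : ∀ m, n + 1 ≤ m → p m u = p m x := by
      intro m hm
      induction m, hm using Nat.le_induction with
      | base => exact hnext
      | succ m _ ih => rw [hp, hp, ih]
    refine Finsupp.ext fun m => ?_
    rw [Finsupp.add_apply, hθ, hθ]
    rcases lt_trichotomy m n with hm | rfl | hm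
    · rw [hd m hm, Finsupp.single_eq_of_ne (by omega), add_zero]
    · rw [Finsupp.single_eq_same]
      simp only [d]
      have := hswap m (p m x) (hpK m x)
      rw [hu]
      by_cases hx : p m x ∈ K (m + 1)
      · rw [if_neg (fun h' => this.1 h' hx), if_pos hx, zero_add]
      · rw [if_pos (this.2 hx), if_neg hx]; decide
    · rw [Finsupp.single_eq_of_ne (by omega), add_zero]
      simp only [d]
      rw [hlater m hm]
  have hdloc : ∀ x m, ∀ᶠ y in 𝓝 x, d y m = d x m := by
    intro x m
    simp only [d]
    have hc := (hpl m).continuous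
    by_cases hx : p m x ∈ K (m + 1)
    · filter_upwards [hc.continuousAt.eventually ((hKc (m + 1)).isOpen.mem_nhds hx)] with y hy
      rw [if_pos hx, if_pos (show p m y ∈ K (m + 1) from hy)]
    · filter_upwards
        [hc.continuousAt.eventually ((hKc (m + 1)).compl.isOpen.mem_nhds hx)] with y hy
      rw [if_neg hx, if_neg (show p m y ∉ K (m + 1) from hy)]
  have hdlocs : ∀ x n, ∀ᶠ y in 𝓝 x, ∀ m < n, d y m = d x m := fun x n =>
    (eventually_all_finite (finite_lt_nat n)).2 fun m _ => hdloc x m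
  have hsingle : ∀ n, LocallyActs G (fun x => θ.symm (θ x + Finsupp.single n 1)) := by
    intro n x
    obtain ⟨z, hz, hz'⟩ := hsurj (d x) n _ (hmaps n _ (hpK n x))
    obtain ⟨a, ha⟩ := hpl n x
    obtain ⟨b, hb⟩ := hpl n z
    obtain ⟨c, hc⟩ := hloc n (p n x)
    have hbz : b⁻¹ • c • a • x = z := by
      rw [inv_smul_eq_iff, ← hb.self_of_nhds, hz, hc.self_of_nhds, ha.self_of_nhds]
    have hcont : Tendsto (fun y : X => b⁻¹ • c • a • y) (𝓝 x) (𝓝 z) := by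
      have : Continuous (fun y : X => b⁻¹ • c • a • y) := by fun_prop
      simpa only [hbz] using this.tendsto x
    refine ⟨b⁻¹ * c * a, ?_⟩
    filter_upwards [ha, hdlocs x n, (hpl n).continuous.continuousAt.eventually hc,
      hcont.eventually hb, hcont.eventually (hdlocs z n)] with y h1 h2 h3 h4 h5
    rw [Equiv.symm_apply_eq, mul_smul, mul_smul]
    refine (hflip n y _ (fun m hm => ?_) ?_).symm
    · rw [h5 m hm, hz' m hm, h2 m hm]
    · rw [h4, smul_inv_smul, h3, h1]
  refine ⟨θ, fun δ => ?_⟩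
  induction δ using Finsupp.induction_linear with
  | zero => simpa using (LocallyActs.id : LocallyActs G fun x : X => x)
  | add δ δ' h1 h2 =>
    have := h2.comp h1
    simpa [add_assoc] using this
  | single n a =>
    by_cases ha : a = 0
    · simpa [ha] using (LocallyActs.id : LocallyActs G fun x : X => x)
    · have ha1 : a = 1 := by revert a; decide
      rw [ha1]
      exact hsingle n

end Swap

section Extension

variable {S : Type*} [TopologicalSpace S]

/-- Dense subsets of extremally disconnected spaces are `C*`-embedded. -/
theorem Dense.exists_continuous_extension [ExtremallyDisconnected S] {Y : Type*}
    [TopologicalSpace Y] [CompactSpace Y] [T2Space Y] {D : Set S} (hD : Dense D) {f : D → Y} (hf : Continuous f) :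
    ∃ F : S → Y, Continuous F ∧ ∀ x : D, F x = f x := by
  have hex : ∀ b : S, ∃ c, Tendsto f (comap ((↑) : D → S) (𝓝 b)) (𝓝 c) := by
    intro b
    have : NeBot (comap ((↑) : D → S) (𝓝 b)) := hD.isDenseInducing_val.comap_nhds_neBot b
    obtain ⟨c, hc⟩ := exists_clusterPt_of_compactSpace (map f (comap ((↑) : D → S) (𝓝 b)))
    refine ⟨c, le_nhds_of_unique_clusterPt fun c' hc' => ?_⟩
    by_contra hne
    obtain ⟨u, v, hu, hv, hcu, hcv, huv⟩ := t2_separation hne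
    obtain ⟨O, hO, hOu⟩ := isOpen_induced_iff.1 (hu.preimage hf)
    obtain ⟨O', hO', hOv⟩ := isOpen_induced_iff.1 (hv.preimage hf)
    have hdisj : Disjoint O O' := by
      rw [disjoint_iff_inter_eq_empty]
      by_contra hcon
      obtain ⟨x, ⟨hx, hx'⟩, hxD⟩ :=
        hD.inter_open_nonempty _ (hO.inter hO') (nonempty_iff_ne_empty.2 hcon)
      have h1 : (⟨x, hxD⟩ : D) ∈ f ⁻¹' u := hOu ▸ hx
      have h2 : (⟨x, hxD⟩ : D) ∈ f ⁻¹' v := hOv ▸ hx'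
      exact disjoint_left.1 huv h1 h2
    have key : ∀ (w : Set Y) (W : Set S) (y : Y), IsOpen w → y ∈ w →
        ((↑) : D → S) ⁻¹' W = f ⁻¹' w →
        ClusterPt y (map f (comap ((↑) : D → S) (𝓝 b))) → b ∈ closure W := by
      intro w W y hw hy hWw hcl
      refine mem_closure_iff.2 fun o ho hbo => ?_
      have h1 := (mapClusterPt_iff_frequently.1 hcl) w (hw.mem_nhds hy)
      obtain ⟨x, hx, hxo⟩ := (h1.and_eventually (preimage_mem_comap (ho.mem_nhds hbo))).exists
      have hxW : x ∈ ((↑) : D → S) ⁻¹' W := hWw ▸ hx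
      exact ⟨x, hxo, hxW⟩
    exact disjoint_left.1
      (ExtremallyDisconnected.disjoint_closure_of_disjoint_isOpen hdisj hO hO')
      (key u O c' hu hcu hOu hc') (key v O' c hv hcv hOv hc)
  exact ⟨hD.extend f, hD.continuous_extend hex, fun x => hD.extend_eq hf x⟩

theorem Dense.eq_of_continuous {Y : Type*} [TopologicalSpace Y] [T2Space Y] {D : Set S}
    (hD : Dense D) {f g : S → Y} (hf : Continuous f) (hg : Continuous g)
    (h : ∀ x ∈ D, f x = g x) (x : S) : f x = g x :=
  congrFun (Continuous.ext_on hD hf hg h) x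

theorem isClopen_interior_of_isClosed [ExtremallyDisconnected S] {F : Set S}
    (hF : IsClosed F) : IsClopen (interior F) := by
  have h : closure (interior F) = interior F :=
    (interior_maximal (closure_minimal interior_subset hF)
      (ExtremallyDisconnected.open_closure _ isOpen_interior)).antisymm subset_closure
  exact ⟨isClosed_of_closure_subset h.le, isOpen_interior⟩

/-- If two continuous maps agree near a point of the dense subset `D` along `D`, they agree
near it. -/
theorem Dense.mem_interior_eqLocus {Y : Type*} [TopologicalSpace Y] [T2Space Y] {D : Set S}
    (hD : Dense D) {f g : S → Y} (hf : Continuous f) (hg : Continuous g) {x : D}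
    (h : ∀ᶠ y : D in 𝓝 x, f y = g y) : (x : S) ∈ interior {y | f y = g y} := by
  rw [nhds_subtype_eq_comap, eventually_comap] at h
  obtain ⟨V, hV, hVo, hxV⟩ := eventually_nhds_iff.1 h
  refine mem_interior.2 ⟨V, ?_, hVo, hxV⟩
  refine (hD.open_subset_closure_inter hVo).trans
    (closure_minimal ?_ (isClosed_eq hf hg))
  rintro y ⟨hyV, hyD⟩
  exact hV y hyV ⟨y, hyD⟩ rfl

theorem stronglyDecomposable_of_cover_s13 {H : Type*} [Countable H] [Nonempty H]
    {act : H → S → S} {Y : Set S} {f : S → S} {O : H → Set S} (hO : ∀ g, IsClopen (O g))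
    (hcov : ∀ x ∈ Y, ∃ g, x ∈ O g) (heq : ∀ g, ∀ x ∈ O g, f x = act g x) :
    StronglyDecomposable act Y f := by
  obtain ⟨e, he⟩ := exists_surjective_nat H
  have hclopen : ∀ n, IsClopen (disjointed (fun n => O (e n)) n) := fun n =>
    disjointedRec (p := fun s => IsClopen s) (fun _ _ h => h.diff (hO _)) (hO (e n))
  refine ⟨fun n => Y ∩ disjointed (fun n => O (e n)) n, e, fun n => ⟨inter_subset_left, ?_⟩,
    fun i j hij => ?_, ?_, ?_⟩
  · rw [Subtype.preimage_coe_self_inter]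
    exact (hclopen n).preimage continuous_subtype_val
  · exact ((disjoint_disjointed _ hij).mono inter_subset_right inter_subset_right)
  · rw [← inter_iUnion, iUnion_disjointed, inter_eq_left]
    intro x hx
    obtain ⟨g, hg⟩ := hcov x hx
    obtain ⟨n, rfl⟩ := he g
    exact mem_iUnion.2 ⟨n, hg⟩
  · exact fun n x hx => heq _ x (disjointed_subset _ n hx.2)

end Extension

theorem exists_dyadic_action {S : Type*} [TopologicalSpace S] [CompactSpace S] [T2Space S]
    [ExtremallyDisconnected S] (hiso : ∀ x : S, ¬ IsOpen ({x} : Set S))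
    {G : Type*} [Group G] [Countable G]
    (ε : G → S ≃ₜ S) (hεone : ε 1 = Homeomorph.refl S)
    (hεmul : ∀ g h : G, ∀ x : S, ε (g * h) x = ε g (ε h x))
    (s₀ : S) (D : Set S) (hDdef : D = Set.range fun g : G => ε g s₀)
    (hdense : Dense D)
    (hpf : ∀ g : G, RelClopen D {z ∈ D | ε g z = z}) :
    ∃ (γ : (ℕ →₀ ZMod 2) → S ≃ₜ S) (Y : Set S),
      (γ 0 = Homeomorph.refl S) ∧
      (∀ δ δ' : ℕ →₀ ZMod 2, ∀ x : S, γ (δ + δ') x = γ δ (γ δ' x)) ∧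
      D ⊆ Y ∧ IsGδ Y ∧
      (∀ δ : ℕ →₀ ZMod 2, δ ≠ 0 → γ δ s₀ ≠ s₀) ∧
      (Set.range fun δ : ℕ →₀ ZMod 2 => γ δ s₀) = D ∧
      (∀ g : G, (ε g) '' Y = Y) ∧ (∀ δ : ℕ →₀ ZMod 2, (γ δ) '' Y = Y) ∧
      StronglyEquivalent (fun (g : G) (x : S) => ε g x)
        (fun (δ : ℕ →₀ ZMod 2) (x : S) => γ δ x) Y ∧
      (∀ x ∈ Y, ∀ y ∈ Y, ((∃ g : G, ε g x = y) ↔ ∃ δ : ℕ →₀ ZMod 2, γ δ x = y)) ∧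
      Function.Injective γ := by
  have hε1 : ∀ x, ε 1 x = x := fun x => by rw [hεone]; rfl
  have hεinv : ∀ g x, ε g⁻¹ (ε g x) = x := fun g x => by rw [← hεmul, inv_mul_cancel, hε1]
  have hεinv' : ∀ g x, ε g (ε g⁻¹ x) = x := fun g x => by rw [← hεmul, mul_inv_cancel, hε1]
  have hεD : ∀ g, ∀ x ∈ D, ε g x ∈ D := by
    rintro g x hx
    rw [hDdef] at hx ⊢
    obtain ⟨k, rfl⟩ := hx
    exact ⟨g * k, hεmul g k s₀⟩
  have hs₀ : s₀ ∈ D := by rw [hDdef]; exact ⟨1, hε1 s₀⟩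
  let _ : MulAction G D :=
    { smul := fun g x => ⟨ε g x, hεD g x x.2⟩
      one_smul := fun x => Subtype.ext (hε1 x)
      mul_smul := fun g k x => Subtype.ext (hεmul g k x) }
  have hsmul : ∀ (g : G) (x : D), ((g • x : D) : S) = ε g x := fun _ _ => rfl
  have : ContinuousConstSMul G D :=
    ⟨fun g => ((ε g).continuous.comp continuous_subtype_val).subtype_mk _⟩
  have : MulAction.IsPretransitive G D := by
    refine ⟨fun x y => ?_⟩
    obtain ⟨a, ha⟩ : (x : S) ∈ Set.range fun g : G => ε g s₀ := hDdef ▸ x.2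
    obtain ⟨b, hb⟩ : (y : S) ∈ Set.range fun g : G => ε g s₀ := hDdef ▸ y.2
    refine ⟨b * a⁻¹, Subtype.ext ?_⟩
    dsimp only at ha hb
    rw [hsmul, ← ha, hεmul, hεinv, hb]
  have : Countable D := by
    rw [hDdef]; exact (countable_range _).to_subtype
  have hbasis : TopologicalSpace.IsTopologicalBasis {s : Set D | IsClopen s} := by
    refine TopologicalSpace.isTopologicalBasis_of_isOpen_of_nhds (fun s hs => IsClopen.isOpen hs)
      fun x U hx hU => ?_
    obtain ⟨O, hO, rfl⟩ := isOpen_induced_iff.1 hU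
    obtain ⟨V, hV, hxV, hVO⟩ := compact_exists_isClopen_in_isOpen hO hx
    exact ⟨_, hV.preimage continuous_subtype_val, hxV, preimage_mono hVO⟩
  have hisoD : ∀ x : D, ¬ IsOpen ({x} : Set D) := by
    intro x hx
    obtain ⟨O, hO, hOx⟩ := isOpen_induced_iff.1 hx
    have hxO : (x : S) ∈ O := by
      have : x ∈ ((↑) : D → S) ⁻¹' O := hOx ▸ rfl
      exact this
    obtain ⟨y, hyO, hne⟩ := exists_ne_mem_of_isOpen hiso hO hxO
    obtain ⟨z, ⟨hzO, hzx⟩, hzD⟩ := hdense.inter_open_nonempty (O \ {(x : S)})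
      (hO.sdiff isClosed_singleton) ⟨y, hyO, fun h => hne h.symm⟩
    have : (⟨z, hzD⟩ : D) ∈ ({x} : Set D) := hOx ▸ hzO
    exact hzx (congrArg Subtype.val this)
  obtain ⟨θ, hθ⟩ := exists_equiv_dyadic (G := G) hbasis hisoD ⟨s₀, hs₀⟩
  have hθ' : ∀ δ (x : D), ∃ g : G, ∀ᶠ y : D in 𝓝 x, θ.symm (θ y + δ) = g • y := hθ
  have hext : ∀ δ, ∃ F : S → S, Continuous F ∧ ∀ x : D, F x = (θ.symm (θ x + δ) : D) := fun δ =>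
    hdense.exists_continuous_extension (continuous_subtype_val.comp (hθ δ).continuous)
  choose F hFc hF using hext
  have hFadd : ∀ δ δ' x, F (δ + δ') x = F δ (F δ' x) := fun δ δ' =>
    hdense.eq_of_continuous (hFc _) ((hFc δ).comp (hFc δ')) fun x hx => by
      rw [hF _ ⟨x, hx⟩, hF _ ⟨x, hx⟩, hF, Equiv.apply_symm_apply, add_assoc, add_comm δ]
  have hF0 : ∀ x, F 0 x = x :=
    hdense.eq_of_continuous (hFc _) continuous_id fun x hx => by
      rw [hF _ ⟨x, hx⟩, add_zero, Equiv.symm_apply_apply]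
  let γ : (ℕ →₀ ZMod 2) → S ≃ₜ S := fun δ =>
    { toFun := F δ
      invFun := F (-δ)
      left_inv := fun x => by rw [← hFadd, neg_add_cancel, hF0]
      right_inv := fun x => by rw [← hFadd, add_neg_cancel, hF0]
      continuous_toFun := hFc δ
      continuous_invFun := hFc (-δ) }
  have hγ : ∀ δ x, γ δ x = F δ x := fun _ _ => rfl
  have hγinv : ∀ δ x, γ δ (γ (-δ) x) = x := fun δ x => by
    rw [hγ, hγ, ← hFadd, add_neg_cancel, hF0]
  have hγD : ∀ δ (x : D), γ δ x = (θ.symm (θ x + δ) : D) := hF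
  clear_value γ
  let O : G → (ℕ →₀ ZMod 2) → Set S := fun g δ => interior {x | ε g x = γ δ x}
  have hOc : ∀ g δ, IsClopen (O g δ) := fun g δ =>
    isClopen_interior_of_isClosed (isClosed_eq (ε g).continuous (γ δ).continuous)
  have hOeq : ∀ g δ, ∀ x ∈ O g δ, ε g x = γ δ x := fun g δ x hx =>
    interior_subset (s := {x | ε g x = γ δ x}) hx
  have hOD : ∀ g δ (x : D), ε g x = γ δ x → (x : S) ∈ O g δ := by
    intro g δ x hx
    refine hdense.mem_interior_eqLocus (ε g).continuous (γ δ).continuous ?_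
    obtain ⟨k, hk⟩ := hθ' δ x
    have hk' : ∀ᶠ y : D in 𝓝 x, γ δ y = ε k y := hk.mono fun y hy => by rw [hγD, hy, hsmul]
    have hfix : x ∈ ((↑) : D → S) ⁻¹' {z ∈ D | ε (g⁻¹ * k) z = z} := by
      refine ⟨x.2, ?_⟩
      rw [hεmul, ← hk'.self_of_nhds, ← hx, hεinv]
    filter_upwards [hk', (hpf (g⁻¹ * k)).2.isOpen.mem_nhds hfix] with y h1 h2
    have h3 : ε (g⁻¹ * k) y = y := h2.2
    rw [hεmul] at h3
    rw [h1, ← hεinv' g (ε k y), h3]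
  let Y₀ : Set S := (⋂ g, ⋃ δ, O g δ) ∩ ⋂ δ, ⋃ g, O g δ
  let Y : Set S := ⋂ g, ε g ⁻¹' Y₀
  have hY₀1 : ∀ x ∈ Y₀, ∀ g, ∃ δ, x ∈ O g δ := fun x hx g => mem_iUnion.1 (mem_iInter.1 hx.1 g)
  have hY₀2 : ∀ x ∈ Y₀, ∀ δ, ∃ g, x ∈ O g δ := fun x hx δ => mem_iUnion.1 (mem_iInter.1 hx.2 δ)
  have hYY₀ : Y ⊆ Y₀ := fun x hx => by simpa [hε1] using mem_iInter.1 hx 1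
  have hDY₀ : D ⊆ Y₀ := by
    intro x hx
    refine ⟨mem_iInter.2 fun g => mem_iUnion.2 ?_, mem_iInter.2 fun δ => mem_iUnion.2 ?_⟩
    · refine ⟨θ (g • ⟨x, hx⟩) - θ ⟨x, hx⟩, hOD g _ ⟨x, hx⟩ ?_⟩
      rw [hγD, add_sub_cancel, Equiv.symm_apply_apply, hsmul]
    · obtain ⟨g, hg⟩ := hθ' δ ⟨x, hx⟩
      refine ⟨g, hOD g δ ⟨x, hx⟩ ?_⟩
      rw [hγD, hg.self_of_nhds, hsmul]
  have hYε : ∀ g, ∀ x ∈ Y, ε g x ∈ Y := fun g x hx => mem_iInter.2 fun k => by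
    have := mem_iInter.1 hx (k * g)
    rwa [mem_preimage, hεmul] at this
  have hYγ : ∀ δ, ∀ x ∈ Y, γ δ x ∈ Y := fun δ x hx => by
    obtain ⟨g, hg⟩ := hY₀2 x (hYY₀ hx) δ
    rw [← hOeq g δ x hg]
    exact hYε g x hx
  have hinj : ∀ δ δ', γ δ s₀ = γ δ' s₀ → δ = δ' := fun δ δ' h => by
    have h1 := hγD δ ⟨s₀, hs₀⟩
    have h2 := hγD δ' ⟨s₀, hs₀⟩
    exact add_left_cancel (θ.symm.injective (Subtype.ext (h1.symm.trans (h.trans h2))))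
  have hγ0 : γ 0 = Homeomorph.refl S := Homeomorph.ext fun x => by rw [hγ, hF0]; rfl
  refine ⟨γ, Y, hγ0, fun δ δ' x => by simp only [hγ, hFadd],
    fun x hx => mem_iInter.2 fun g => hDY₀ (hεD g x hx), ?_, ?_, ?_, ?_, ?_, ⟨?_, ?_⟩, ?_, ?_⟩
  · have hY₀ : IsGδ Y₀ :=
      (IsGδ.iInter_of_isOpen fun g => isOpen_iUnion fun δ => (hOc g δ).isOpen).inter
        (IsGδ.iInter_of_isOpen fun δ => isOpen_iUnion fun g => (hOc g δ).isOpen)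
    exact IsGδ.iInter fun g => hY₀.preimage (ε g).continuous
  · intro δ hδ h
    refine hδ (hinj δ 0 ?_)
    rw [h, hγ0]; rfl
  · ext x
    constructor
    · rintro ⟨δ, rfl⟩
      have h1 := hγD δ ⟨s₀, hs₀⟩
      dsimp only at h1 ⊢
      rw [h1]; exact Subtype.coe_prop _
    · intro hx
      refine ⟨θ ⟨x, hx⟩ - θ ⟨s₀, hs₀⟩, ?_⟩
      have h1 := hγD (θ ⟨x, hx⟩ - θ ⟨s₀, hs₀⟩) ⟨s₀, hs₀⟩
      rwa [add_sub_cancel, Equiv.symm_apply_apply] at h1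
  · intro g
    refine Subset.antisymm (by rintro _ ⟨x, hx, rfl⟩; exact hYε g x hx)
      fun x hx => ⟨ε g⁻¹ x, hYε _ x hx, hεinv' g x⟩
  · intro δ
    refine Subset.antisymm (by rintro _ ⟨x, hx, rfl⟩; exact hYγ δ x hx)
      fun x hx => ⟨γ (-δ) x, hYγ _ x hx, hγinv δ x⟩
  · exact fun δ => stronglyDecomposable_of_cover_s13 (O := fun g => O g δ) (fun g => hOc g δ)
      (fun x hx => hY₀2 x (hYY₀ hx) δ) fun g x hx => (hOeq g δ x hx).symm
  · exact fun g => stronglyDecomposable_of_cover_s13 (O := fun δ => O g δ) (fun δ => hOc g δ)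
      (fun x hx => hY₀1 x (hYY₀ hx) g) fun δ x hx => hOeq g δ x hx
  · intro x hx y _
    constructor
    · rintro ⟨g, rfl⟩
      obtain ⟨δ, hδ⟩ := hY₀1 x (hYY₀ hx) g
      exact ⟨δ, (hOeq g δ x hδ).symm⟩
    · rintro ⟨δ, rfl⟩
      obtain ⟨g, hg⟩ := hY₀2 x (hYY₀ hx) δ
      exact ⟨g, hOeq g δ x hg⟩
  · exact fun δ δ' h => hinj δ δ' (by rw [h])

end DyadicAction

/-- Let `S` be a compact Hausdorff extremally disconnected space with no isolated points,
`G` a countably infinite group and `ε : G → Homeo(S)` an injective action of `G` on `S` by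
homeomorphisms.  Let `s₀ ∈ S` be such that the orbit `D = {ε g s₀ : g ∈ G}` is dense in
`S` and the action is pseudo-free on `D`.  Then there exist an action `γ` of the dyadic
group `⊕ℤ₂` (formalised as the additive group `ℕ →₀ ZMod 2`) on `S` by homeomorphisms and
a `Gδ` subset `Y` of `S` with `D ⊆ Y` such that:
(1) the orbit `{γ δ s₀ : δ ∈ ⊕ℤ₂}` is free and coincides with `D`;
(2) `Y` is invariant under both `ε[G]` and `γ[⊕ℤ₂]`, and these two groups of
homeomorphisms are strongly equivalent over `Y`;
(3) the orbit equivalence relations on `Y` induced by `ε[G]` and by `γ[⊕ℤ₂]` coincide;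
(4) `γ` is injective (an isomorphism onto its image). -/
theorem stmt_13 {S : Type*} [TopologicalSpace S] [CompactSpace S] [T2Space S]
    [ExtremallyDisconnected S] (hiso : ∀ x : S, ¬ IsOpen ({x} : Set S))
    {G : Type*} [Group G] [Countable G] [Infinite G]
    (ε : G → S ≃ₜ S) (hεone : ε 1 = Homeomorph.refl S)
    (hεmul : ∀ g h : G, ∀ x : S, ε (g * h) x = ε g (ε h x))
    (hεinj : Function.Injective ε)
    (s₀ : S) (D : Set S) (hDdef : D = Set.range fun g : G => ε g s₀)
    (hdense : Dense D)
    (hpf : ∀ g : G, RelClopen D {z ∈ D | ε g z = z}) :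
    ∃ (γ : (ℕ →₀ ZMod 2) → S ≃ₜ S) (Y : Set S),
      (γ 0 = Homeomorph.refl S) ∧
      (∀ δ δ' : ℕ →₀ ZMod 2, ∀ x : S, γ (δ + δ') x = γ δ (γ δ' x)) ∧
      D ⊆ Y ∧ IsGδ Y ∧
      (∀ δ : ℕ →₀ ZMod 2, δ ≠ 0 → γ δ s₀ ≠ s₀) ∧
      (Set.range fun δ : ℕ →₀ ZMod 2 => γ δ s₀) = D ∧
      (∀ g : G, (ε g) '' Y = Y) ∧ (∀ δ : ℕ →₀ ZMod 2, (γ δ) '' Y = Y) ∧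
      StronglyEquivalent (fun (g : G) (x : S) => ε g x)
        (fun (δ : ℕ →₀ ZMod 2) (x : S) => γ δ x) Y ∧
      (∀ x ∈ Y, ∀ y ∈ Y, ((∃ g : G, ε g x = y) ↔ ∃ δ : ℕ →₀ ZMod 2, γ δ x = y)) ∧
      Function.Injective γ := by
  exact exists_dyadic_action hiso ε hεone hεmul s₀ D hDdef hdense hpf
end

section
/- Let B be a Boolean algebra in which every countable subset has a supremum (a Boolean σ-algebra), and let (p_n) (n = 1, 2, ...) be a sequence in B which σ-generates B. Let Γ be a group of Boolean-algebra automorphisms of B which is the union of an increasing sequence (Γ_n) of finite subgroups. Then there exists an increasing sequence (B_n) of finite Boolean subalgebras of B such that for each n: B_n is invariant under the action of Γ_n (g[B_n] = B_n for every g ∈ Γ_n), p_n ∈ B_n, and consequently the union ⋃_n B_n σ-generates B. -/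
open Pointwise

/-- `C` is a Boolean subalgebra of `B`: it contains `⊥` and `⊤` and is closed under
meets, joins and complementation. -/
def IsBooleanSubalg {B : Type*} [BooleanAlgebra B] (C : Set B) : Prop :=
  ⊥ ∈ C ∧ ⊤ ∈ C ∧ (∀ a ∈ C, ∀ b ∈ C, a ⊓ b ∈ C) ∧ (∀ a ∈ C, ∀ b ∈ C, a ⊔ b ∈ C) ∧
    ∀ a ∈ C, aᶜ ∈ C

/-- A subset `X` σ-generates the Boolean σ-algebra `B` if every subset of `B` containing
`X` which is a Boolean subalgebra and is closed under suprema of countable subsets is all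
of `B`. -/
def SigmaGenerates {B : Type*} [BooleanAlgebra B] (X : Set B) : Prop :=
  ∀ C : Set B, X ⊆ C → IsBooleanSubalg C →
    (∀ s : Set B, s ⊆ C → s.Countable → ∀ a : B, IsLUB s a → a ∈ C) →
    C = Set.univ

/-- The Boolean subalgebra generated by a finite set is finite. -/
theorem BooleanSubalgebra.finite_closure {B : Type*} [BooleanAlgebra B] {s : Set B}
    (hs : s.Finite) : (BooleanSubalgebra.closure s : Set B).Finite := by
  let t : Set B := latticeClosure (insert ⊥ (insert ⊤ s))
  have htfin : t.Finite := ((hs.insert ⊤).insert ⊥).latticeClosure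
  have hsub : insert ⊥ (insert ⊤ s) ⊆ t := subset_latticeClosure
  have := htfin.to_subtype
  refine (Set.finite_range fun u : Finset (t × t) ↦ u.sup fun x ↦ x.1.1 \ x.2.1).subset ?_
  intro a ha
  have hat : a ∈ BooleanSubalgebra.closure t :=
    BooleanSubalgebra.closure_mono
      (((Set.subset_insert _ _).trans (Set.subset_insert _ _)).trans hsub) ha
  obtain ⟨u, rfl⟩ := (BooleanSubalgebra.mem_closure_iff_sup_sdiff
    isSublattice_latticeClosure (hsub (by simp)) (hsub (by simp))).1 hat
  exact ⟨u, rfl⟩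

theorem BooleanSubalgebra.isBooleanSubalg {B : Type*} [BooleanAlgebra B]
    (L : BooleanSubalgebra B) : IsBooleanSubalg (L : Set B) :=
  ⟨L.bot_mem, L.top_mem, fun _ ha _ hb ↦ L.inf_mem ha hb, fun _ ha _ hb ↦ L.sup_mem ha hb,
    fun _ ha ↦ L.compl_mem ha⟩

/-- A self-map commuting with joins and complements which preserves a set also preserves the
Boolean subalgebra it generates. -/
theorem BooleanSubalgebra.mapsTo_closure {B : Type*} [BooleanAlgebra B] {f : B → B} {s : Set B}
    (hsup : ∀ a b, f (a ⊔ b) = f a ⊔ f b) (hcompl : ∀ a, f aᶜ = (f a)ᶜ)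
    (hs : Set.MapsTo f s s) :
    Set.MapsTo f (BooleanSubalgebra.closure s) (BooleanSubalgebra.closure s) := by
  intro x hx
  induction hx using BooleanSubalgebra.closure_bot_sup_induction with
  | mem x hx => exact BooleanSubalgebra.subset_closure (hs hx)
  | bot =>
    have htop : f ⊤ = ⊤ := by
      have h := hsup ⊤ ⊤ᶜ
      rwa [hcompl, sup_compl_eq_top, sup_compl_eq_top] at h
    rw [← compl_top, hcompl, htop, compl_top]
    exact BooleanSubalgebra.bot_mem
  | sup x _ y _ hx hy => rw [hsup]; exact BooleanSubalgebra.sup_mem hx hy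
  | compl x _ hx => rw [hcompl]; exact BooleanSubalgebra.compl_mem hx

theorem SigmaGenerates.mono {B : Type*} [BooleanAlgebra B] {X Y : Set B}
    (hX : SigmaGenerates X) (hXY : X ⊆ Y) : SigmaGenerates Y :=
  fun C hC ↦ hX C (hXY.trans hC)

/-- Let `B` be a Boolean algebra in which every countable subset has a supremum (a Boolean
σ-algebra), and let `(p n)` be a sequence in `B` which σ-generates `B`.  Let `Γ` be a
group acting on `B` by Boolean-algebra automorphisms, which is the union of an increasing
sequence `(Γn)` of finite subgroups.  Then there exists an increasing sequence `(Bn)` of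
finite Boolean subalgebras of `B` such that each `Bn` is invariant under the action of
`Γn`, contains `p n`, and consequently the union `⋃ n, Bn` σ-generates `B`. -/
theorem stmt_17 {B : Type*} [BooleanAlgebra B]
    (hsup : ∀ s : Set B, s.Countable → ∃ a : B, IsLUB s a)
    (p : ℕ → B) (hgen : SigmaGenerates (Set.range p))
    {Γ : Type*} [Group Γ] [MulAction Γ B]
    (hact : ∀ γ : Γ, ∀ a b : B, γ • (a ⊔ b) = γ • a ⊔ γ • b ∧
      γ • (a ⊓ b) = γ • a ⊓ γ • b ∧ γ • aᶜ = (γ • a)ᶜ)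
    (Γn : ℕ → Subgroup Γ) (hmono : Monotone Γn) (hfin : ∀ n, (Γn n : Set Γ).Finite)
    (hunion : (⋃ n, (Γn n : Set Γ)) = Set.univ) :
    ∃ Bn : ℕ → Set B, Monotone Bn ∧ (∀ n, (Bn n).Finite) ∧
      (∀ n, IsBooleanSubalg (Bn n)) ∧
      (∀ n, ∀ γ ∈ Γn n, γ • Bn n = Bn n) ∧
      (∀ n, p n ∈ Bn n) ∧
      SigmaGenerates (⋃ n, Bn n) := by
  have hmaps (n : ℕ) (γ : Γ) (hγ : γ ∈ Γn n) :
      Set.MapsTo (γ • ·) ((Γn n : Set Γ) • (p '' Set.Iic n))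
        ((Γn n : Set Γ) • (p '' Set.Iic n)) := by
    rintro _ ⟨δ, hδ, x, hx, rfl⟩
    exact ⟨γ * δ, mul_mem hγ hδ, x, hx, mul_smul γ δ x⟩
  have hinv (n : ℕ) (γ : Γ) (hγ : γ ∈ Γn n) := BooleanSubalgebra.mapsTo_closure
    (fun a b ↦ (hact γ a b).1) (fun a ↦ (hact γ a a).2.2) (hmaps n γ hγ)
  have hp (n : ℕ) : p n ∈ BooleanSubalgebra.closure ((Γn n : Set Γ) • (p '' Set.Iic n)) :=
    BooleanSubalgebra.subset_closure
      ⟨1, one_mem _, p n, Set.mem_image_of_mem p Set.self_mem_Iic, one_smul Γ (p n)⟩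
  refine ⟨fun n ↦ BooleanSubalgebra.closure ((Γn n : Set Γ) • (p '' Set.Iic n)), ?_,
    fun n ↦ BooleanSubalgebra.finite_closure ((hfin n).smul ((Set.finite_Iic n).image p)),
    fun n ↦ BooleanSubalgebra.isBooleanSubalg _, ?_, hp,
    hgen.mono (Set.range_subset_iff.2 fun n ↦ Set.mem_iUnion.2 ⟨n, hp n⟩)⟩
  · intro m n hmn
    exact BooleanSubalgebra.closure_mono
      (Set.smul_subset_smul (hmono hmn) (Set.image_mono (Set.Iic_subset_Iic.2 hmn)))
  · intro n γ hγ
    refine Set.Subset.antisymm (Set.image_subset_iff.2 (hinv n γ hγ)) fun x hx ↦ ?_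
    exact ⟨γ⁻¹ • x, hinv n γ⁻¹ (inv_mem hγ) hx, smul_inv_smul γ x⟩
end

section
/- Let (T, O) be a feasible pair, R ⊆ T admissible, and X_R = {f_k : k ∈ F(ℕ)} with the subspace topology inherited from the product topology on {0,1}^{F(ℕ)×F(T)}. For each n ∈ ℕ define σ_n : X_R → X_R by σ_n(f_k) = f_{k \ {n}} if n ∈ k and σ_n(f_k) = f_{k ∪ {n}} if n ∉ k (well defined since k ↦ f_k is injective). Then σ_n is continuous; since σ_n ∘ σ_n is the identity, σ_n is a homeomorphism of X_R onto itself. -/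
theorem Fin.eq_of_eq_one_iff {a b : Fin 2} (h : a = 1 ↔ b = 1) : a = b := by
  omega

/-- Toggling the membership of `n` in `k` twice gives back `k`. -/
theorem Finset.toggle_toggle {α : Type*} [DecidableEq α] (n : α) (k : Finset α) :
    (if n ∈ (if n ∈ k then k.erase n else insert n k)
      then (if n ∈ k then k.erase n else insert n k).erase n
      else insert n (if n ∈ k then k.erase n else insert n k)) = k := by
  by_cases h : n ∈ k <;> simp [h]


section InsertErase

variable {α : Type*} [DecidableEq α] {n : α} {k l : Finset α}

theorem Finset.insert_sdiff_eq_sdiff_erase (hl : n ∈ l) (hk : n ∉ k) :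
    insert n k \ l = k \ l.erase n := by
  grind

theorem Finset.erase_sdiff_eq_sdiff_insert (k l : Finset α) (n : α) :
    k.erase n \ l = k \ insert n l := by
  grind

theorem Finset.subset_erase_iff_insert_subset (hl : n ∉ l) (hk : n ∈ k) :
    l ⊆ k.erase n ↔ insert n l ⊆ k := by
  grind

end InsertErase

/-- Let `(T, O)` be a feasible pair, `R ⊆ T` admissible, and
`X_R = {f k : k ∈ F(ℕ)} ⊆ {0,1}^{F(ℕ) × F(T)}` with the subspace topology inherited from
the product topology, where `f k` is the characteristic function of
`{(l, L) : L ⊆ T \ R, l ⊆ k, N(t) ∩ (k \ l) = ∅ for every t ∈ L}` and `N(t) = {n : t ∈ O n}`.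
For each `n ∈ ℕ` let `σ n : X_R → X_R` be the map given on points by
`σ n (f k) = f (k \ {n})` if `n ∈ k` and `σ n (f k) = f (k ∪ {n})` if `n ∉ k`
(well defined since `k ↦ f k` is injective).  Then each `σ n` is continuous, satisfies
`σ n ∘ σ n = id`, and hence is a homeomorphism of `X_R` onto itself. -/
theorem stmt_19 {T : Type*} (hT : Cardinal.mk T = Cardinal.continuum)
    (O : ℕ → Set T) (hO1 : ∀ n, (O n).Nonempty) (hO2 : Function.Injective O)
    (hO3 : ∀ M : Set T, M.Finite → ∀ t ∉ M,
      {n : ℕ | t ∈ O n ∧ O n ∩ M = ∅}.Infinite)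
    (R : Set T) (hR1 : Cardinal.mk R = Cardinal.continuum)
    (hR2 : Cardinal.mk (Rᶜ : Set T) = Cardinal.continuum)
    (hR3 : ∀ n, ¬ O n ⊆ R)
    (f : Finset ℕ → (Finset ℕ × Finset T → Fin 2))
    (hf : ∀ (k l : Finset ℕ) (L : Finset T),
      f k (l, L) = 1 ↔
        ((L : Set T) ⊆ Rᶜ ∧ l ⊆ k ∧ ∀ t ∈ L, ∀ n ∈ k \ l, t ∉ O n))
    (X : Set (Finset ℕ × Finset T → Fin 2)) (hX : X = Set.range f)
    (σ : ℕ → X → X)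
    (hσ : ∀ (n : ℕ) (k : Finset ℕ) (hk : f k ∈ X),
      (σ n ⟨f k, hk⟩ : X).val = f (if n ∈ k then k.erase n else insert n k)) :
    ∀ n : ℕ, Continuous (σ n) ∧ (∀ x : X, σ n (σ n x) = x) ∧
      ∃ e : X ≃ₜ X, ⇑e = σ n := by
  intro n
  have hmem : ∀ k, f k ∈ X := fun k => hX ▸ Set.mem_range_self k
  have hrep : ∀ x : X, ∃ k, x = ⟨f k, hmem k⟩ := by
    rintro ⟨x, hx⟩
    obtain ⟨k, rfl⟩ : x ∈ Set.range f := hX ▸ hx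
    exact ⟨k, rfl⟩
  have hinv : ∀ x : X, σ n (σ n x) = x := by
    intro x
    obtain ⟨k, rfl⟩ := hrep x
    have h : σ n ⟨f k, hmem k⟩ =
        ⟨f (if n ∈ k then k.erase n else insert n k), hmem _⟩ := Subtype.ext (hσ n k _)
    rw [h]
    apply Subtype.ext
    rw [hσ, Finset.toggle_toggle]
  have hcoord : ∀ a, Continuous fun x : X => x.val a := fun a =>
    (continuous_apply a).comp continuous_subtype_val
  have hcont : Continuous (σ n) := by
    refine Continuous.subtype_mk (continuous_pi ?_) fun x => (σ n x).2
    rintro ⟨l, L⟩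
    by_cases hn : n ∈ l
    · let G : Fin 2 × Fin 2 → Fin 2 := fun p => if p.1 = 1 then 0 else p.2
      have hval : (fun x : X => (σ n x).val (l, L)) =
          G ∘ fun x : X => (x.val ({n}, ∅), x.val (l.erase n, L)) := by
        funext x
        obtain ⟨k, rfl⟩ := hrep x
        apply Fin.eq_of_eq_one_iff
        rw [hσ, hf]
        simp only [G, Function.comp_apply]
        by_cases hk : n ∈ k
        · have h1 : f k ({n}, ∅) = 1 := by simp [hf, hk]
          simp only [hk, h1, if_true]
          refine iff_of_false (fun h => ?_) (by decide)
          exact Finset.notMem_erase n k (h.2.1 hn)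
        · have h1 : f k ({n}, ∅) ≠ 1 := by simp [hf, hk]
          simp only [hk, h1, if_false, hf]
          rw [Finset.insert_sdiff_eq_sdiff_erase hn hk, Finset.subset_insert_iff]
      rw [hval]
      exact continuous_of_discreteTopology.comp ((hcoord _).prodMk (hcoord _))
    · classical
      let G : Fin 2 × Fin 2 × Fin 2 → Fin 2 := fun p =>
        if p.1 = 1 then p.2.1 else if ∀ t ∈ L, t ∉ O n then p.2.2 else 0
      have hval : (fun x : X => (σ n x).val (l, L)) =
          G ∘ fun x : X => (x.val ({n}, ∅), x.val (insert n l, L), x.val (l, L)) := by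
        funext x
        obtain ⟨k, rfl⟩ := hrep x
        apply Fin.eq_of_eq_one_iff
        rw [hσ, hf]
        simp only [G, Function.comp_apply]
        by_cases hk : n ∈ k
        · have h1 : f k ({n}, ∅) = 1 := by simp [hf, hk]
          simp only [hk, h1, if_true, hf]
          rw [Finset.erase_sdiff_eq_sdiff_insert, Finset.subset_erase_iff_insert_subset hn hk]
        · have h1 : f k ({n}, ∅) ≠ 1 := by simp [hf, hk]
          simp only [hk, h1, if_false]
          rw [Finset.insert_sdiff_of_notMem _ hn, Finset.subset_insert_iff_of_notMem hn]
          simp only [Finset.forall_mem_insert]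
          split_ifs with h
          · rw [hf]
            exact and_congr_right fun _ => and_congr_right fun _ =>
              forall₂_congr fun t ht => and_iff_right (h t ht)
          · refine iff_of_false (fun h' => ?_) (by decide)
            exact h fun t ht => (h'.2.2 t ht).1
      rw [hval]
      exact continuous_of_discreteTopology.comp
        ((hcoord _).prodMk ((hcoord _).prodMk (hcoord _)))
  exact ⟨hcont, hinv, ⟨⟨σ n, σ n, hinv, hinv⟩, hcont, hcont⟩, rfl⟩
end
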